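/- arXiv:2603.06261 — 2 statements merged into one kernel-verified Lean document; each statement's English description precedes it below -/
import Mathlib

section
/- For every integer k ≥ 3 there exists a constant H > 0 such that m_n^{(k)} = H · (n · P(W > √n))^k · (1 + o(1)) as n → ∞; in particular, since P(W > x) = x^{-α}(1+o(1)), one has m_n^{(k)} / n^{k(2−α)/2} → H, so m_n^{(k)} grows polynomially with exponent k(2−α)/2. -/
open MeasureTheory Filter Set

noncomputable section

/-- `f_n(h_1,…,h_k) = ∏_{1≤i<j≤k} min(h_i h_j/(μ n), 1)`. -/
def fDef (μ : ℝ) (n k : ℕ) (x : Fin k → ℝ) : ℝ :=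
  ∏ p ∈ Finset.univ.filter (fun p : Fin k × Fin k => p.1 < p.2),
    min (x p.1 * x p.2 / (μ * n)) 1

/-- Expected `k`-clique count `m_n^{(k)}`. -/
def mExp (ν : Measure ℝ) (μ : ℝ) (k n : ℕ) : ℝ :=
  (n.choose k : ℝ) *
    ∫ x in Set.univ.pi (fun _ : Fin k => Set.Ici (1 : ℝ)),
      fDef μ n k x ∂(Measure.pi fun _ : Fin k => ν)

/-- tail -/
def Gt (ν : Measure ℝ) (x : ℝ) : ℝ := (ν (Set.Ioi x)).toReal

/-- tail quantile -/
def Qt (ν : Measure ℝ) (u : ℝ) : ℝ := if 0 < u then sInf {x | 1 ≤ x ∧ Gt ν x ≤ u} else 0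

lemma Gt_anti (ν : Measure ℝ) [IsProbabilityMeasure ν] : Antitone (Gt ν) := by
  intro x y h
  exact ENNReal.toReal_mono (measure_ne_top _ _) (measure_mono (Set.Ioi_subset_Ioi h))

lemma Gt_tendsto (ν : Measure ℝ) [IsProbabilityMeasure ν] : Tendsto (Gt ν) atTop (nhds 0) := by
  have h := tendsto_measure_iInter_atTop (μ := ν) (s := fun x : ℝ => Set.Ioi x)
    (fun i => measurableSet_Ioi.nullMeasurableSet) (fun x y h => Set.Ioi_subset_Ioi h)
    ⟨0, measure_ne_top _ _⟩
  have h2 : (⋂ x : ℝ, Set.Ioi x) = ∅ := by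
    ext y; simp only [Set.mem_iInter, Set.mem_Ioi, Set.mem_empty_iff_false, iff_false, not_forall]
    exact ⟨y, lt_irrefl y⟩
  rw [h2, measure_empty] at h
  have := (ENNReal.tendsto_toReal ENNReal.zero_ne_top).comp h
  rw [ENNReal.toReal_zero] at this
  exact this

lemma Gt_right (ν : Measure ℝ) [IsProbabilityMeasure ν] (x u : ℝ)
    (h : ∀ y, x < y → Gt ν y ≤ u) : Gt ν x ≤ u := by
  have hs : Set.Ioi x = ⋃ m : ℕ, Set.Ioi (x + 1 / ((m : ℝ) + 1)) := by
    ext y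
    simp only [Set.mem_Ioi, Set.mem_iUnion]
    constructor
    · intro hy
      obtain ⟨m, hm⟩ := exists_nat_one_div_lt (sub_pos.2 hy)
      exact ⟨m, by linarith⟩
    · rintro ⟨m, hm⟩
      have : (0 : ℝ) < 1 / ((m : ℝ) + 1) := by positivity
      linarith
  have hmono : Monotone (fun m : ℕ => Set.Ioi (x + 1 / ((m : ℝ) + 1))) := by
    intro a b hab
    apply Set.Ioi_subset_Ioi
    gcongr
  have h1 := tendsto_measure_iUnion_atTop (μ := ν) hmono
  rw [← hs] at h1
  have h2 := (ENNReal.tendsto_toReal (measure_ne_top ν _)).comp h1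
  refine le_of_tendsto h2 (Eventually.of_forall fun m => h _ ?_)
  have : (0 : ℝ) < 1 / ((m : ℝ) + 1) := by positivity
  linarith

lemma Qt_le_iff (ν : Measure ℝ) [IsProbabilityMeasure ν] {u : ℝ} (hu : 0 < u) (x : ℝ) :
    Qt ν u ≤ x ↔ 1 ≤ x ∧ Gt ν x ≤ u := by
  have hb : BddBelow {x | 1 ≤ x ∧ Gt ν x ≤ u} := ⟨1, fun y hy => hy.1⟩
  have hne : {x | 1 ≤ x ∧ Gt ν x ≤ u}.Nonempty := by
    have := ((Gt_tendsto ν).eventually (eventually_le_nhds hu)).and (eventually_ge_atTop 1)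
    obtain ⟨y, hy⟩ := this.exists
    exact ⟨y, hy.2, hy.1⟩
  rw [Qt, if_pos hu]
  constructor
  · intro h
    refine ⟨(le_csInf hne fun y hy => hy.1).trans h, ?_⟩
    apply Gt_right
    intro y hy
    obtain ⟨z, hz, hzy⟩ := exists_lt_of_csInf_lt hne (h.trans_lt hy)
    exact (Gt_anti ν hzy.le).trans hz.2
  · intro h
    exact csInf_le hb h

lemma one_le_Qt (ν : Measure ℝ) [IsProbabilityMeasure ν] {u : ℝ} (hu : 0 < u) :
    1 ≤ Qt ν u := ((Qt_le_iff ν hu _).1 le_rfl).1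

lemma Qt_meas (ν : Measure ℝ) [IsProbabilityMeasure ν] : Measurable (Qt ν) := by
  apply measurable_of_Iic
  intro x
  have : Qt ν ⁻¹' Set.Iic x =
      (Set.Ioi 0 ∩ {u | 1 ≤ x ∧ Gt ν x ≤ u}) ∪ (Set.Iic 0 ∩ {u | 0 ≤ x}) := by
    ext u
    simp only [Set.mem_preimage, Set.mem_Iic, Set.mem_union, Set.mem_inter_iff, Set.mem_Ioi,
      Set.mem_ofPred_eq]
    rcases lt_or_ge 0 u with hu | hu
    · rw [Qt_le_iff ν hu]; simp [hu, not_le.2 hu]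
    · simp [Qt, hu, not_lt.2 hu]
  rw [this]
  refine ((measurableSet_Ioi).inter ?_).union (measurableSet_Iic.inter (MeasurableSet.const _))
  exact (MeasurableSet.const (1 ≤ x)).inter measurableSet_Ici

lemma Gt_le_one (ν : Measure ℝ) [IsProbabilityMeasure ν] (x : ℝ) : Gt ν x ≤ 1 := by
  have := ENNReal.toReal_mono ENNReal.one_ne_top (prob_le_one (μ := ν) (s := Set.Ioi x))
  simpa [Gt] using this

lemma map_Qt (ν : Measure ℝ) [IsProbabilityMeasure ν] (hsupp : ν (Set.Iio 1) = 0) :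
    (volume.restrict (Set.Ioo (0:ℝ) 1)).map (Qt ν) = ν := by
  have : IsFiniteMeasure ((volume.restrict (Set.Ioo (0:ℝ) 1)).map (Qt ν)) :=
    Measure.isFiniteMeasure_map _ _
  apply Measure.ext_of_Iic
  intro x
  rw [Measure.map_apply (Qt_meas ν) measurableSet_Iic,
    Measure.restrict_apply (Qt_meas ν measurableSet_Iic)]
  rcases lt_or_ge x 1 with hx | hx
  · have h1 : ν (Set.Iic x) = 0 :=
      measure_mono_null (fun y hy => lt_of_le_of_lt hy hx) hsupp
    have h2 : Qt ν ⁻¹' Set.Iic x ∩ Set.Ioo 0 1 = ∅ := by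
      ext u
      simp only [Set.mem_inter_iff, Set.mem_preimage, Set.mem_Iic, Set.mem_Ioo,
        Set.mem_empty_iff_false, iff_false, not_and]
      intro h hu
      have := one_le_Qt ν hu
      linarith
    rw [h1, h2, measure_empty]
  · have h0 : 0 ≤ Gt ν x := ENNReal.toReal_nonneg
    have hE : (Qt ν ⁻¹' Set.Iic x ∩ Set.Ioo 0 1 : Set ℝ) =ᵐ[volume] Set.Icc (Gt ν x) 1 := by
      have : ∀ᵐ u : ℝ, u ≠ 0 ∧ u ≠ 1 := by
        have a : ∀ c : ℝ, ∀ᵐ u : ℝ, u ≠ c := fun c => by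
          simp [ae_iff]
        filter_upwards [a 0, a 1] with u h1 h2 using ⟨h1, h2⟩
      filter_upwards [this] with u hu
      apply propext
      change (u ∈ Qt ν ⁻¹' Set.Iic x ∩ Set.Ioo 0 1) ↔ (u ∈ Set.Icc (Gt ν x) 1)
      simp only [Set.mem_inter_iff, Set.mem_preimage, Set.mem_Iic, Set.mem_Ioo, Set.mem_Icc]
      constructor
      · rintro ⟨h, h1, h2⟩
        exact ⟨((Qt_le_iff ν h1 x).1 h).2, h2.le⟩
      · rintro ⟨h, h1⟩
        have hp : 0 < u := lt_of_le_of_ne (h0.trans h) (Ne.symm hu.1)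
        exact ⟨(Qt_le_iff ν hp x).2 ⟨hx, h⟩, hp, lt_of_le_of_ne h1 hu.2⟩
    rw [measure_congr hE, Real.volume_Icc]
    have : Set.Iic x = (Set.Ioi x)ᶜ := by simp
    rw [this, prob_compl_eq_one_sub measurableSet_Ioi, ENNReal.ofReal_sub _ h0, Gt,
      ENNReal.ofReal_toReal (measure_ne_top _ _), ENNReal.ofReal_one]

lemma Gt_bound (ν : Measure ℝ) [IsProbabilityMeasure ν] {α : ℝ} (hα : 0 < α)
    (htail : Tendsto (fun x : ℝ => x ^ α * Gt ν x) atTop (nhds 1)) :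
    ∃ C : ℝ, 1 ≤ C ∧ ∀ x, 1 ≤ x → Gt ν x ≤ C * x ^ (-α) := by
  obtain ⟨X, hX⟩ := ((htail.eventually (eventually_le_nhds (show (1:ℝ) < 2 by norm_num))).and
    (eventually_ge_atTop 1)).exists_forall_of_atTop
  have hX1 := (hX X le_rfl).2
  refine ⟨2 * X ^ α, ?_, ?_⟩
  · have := Real.one_le_rpow hX1 hα.le
    linarith
  · intro x hx
    have hx0 : 0 < x := by linarith
    have hp : 0 < x ^ α := Real.rpow_pos_of_pos hx0 _
    have hXp := Real.one_le_rpow hX1 hα.le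
    rw [Real.rpow_neg hx0.le, ← div_eq_mul_inv, le_div_iff₀ hp, mul_comm]
    rcases le_total X x with h | h
    · have := (hX x h).1
      linarith
    · have h1 : x ^ α ≤ X ^ α := Real.rpow_le_rpow hx0.le h hα.le
      have h2 := Gt_le_one ν x
      have h3 : x ^ α * Gt ν x ≤ x ^ α * 1 := by gcongr
      linarith

lemma Qt_bound (ν : Measure ℝ) [IsProbabilityMeasure ν] {α : ℝ} (hα : 0 < α)
    (htail : Tendsto (fun x : ℝ => x ^ α * Gt ν x) atTop (nhds 1)) :
    ∃ C : ℝ, 1 ≤ C ∧ ∀ u, 0 < u → u < 1 → Qt ν u ≤ C * u ^ (-(1/α)) := by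
  obtain ⟨C, hC, h⟩ := Gt_bound ν hα htail
  have hC0 : 0 < C := by linarith
  refine ⟨C ^ (1/α), Real.one_le_rpow hC (by positivity), ?_⟩
  intro u hu hu1
  have hge : 1 ≤ C ^ (1/α) * u ^ (-(1/α)) := by
    have h1 := Real.one_le_rpow hC (show 0 ≤ 1/α by positivity)
    have h2 := Real.one_le_rpow_of_pos_of_le_one_of_nonpos hu hu1.le
      (show -(1/α) ≤ 0 by rw [neg_nonpos]; positivity)
    nlinarith
  rw [Qt_le_iff ν hu]
  refine ⟨hge, (h _ hge).trans (le_of_eq ?_)⟩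
  rw [Real.mul_rpow (by positivity) (by positivity), ← Real.rpow_mul hC0.le, ← Real.rpow_mul hu.le]
  have e1 : 1 / α * -α = -1 := by field_simp
  have e2 : -(1 / α) * -α = 1 := by field_simp
  rw [e1, e2, Real.rpow_one, Real.rpow_neg_one]
  field_simp

lemma Qt_tendsto (ν : Measure ℝ) [IsProbabilityMeasure ν] {α : ℝ} (hα : 0 < α)
    (htail : Tendsto (fun x : ℝ => x ^ α * Gt ν x) atTop (nhds 1)) :
    Tendsto (fun u : ℝ => u ^ (1/α) * Qt ν u) (nhdsWithin 0 (Set.Ioi 0)) (nhds 1) := by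
  have hpos : ∀ᶠ u : ℝ in nhdsWithin 0 (Set.Ioi 0), 0 < u := self_mem_nhdsWithin
  have hinf : ∀ c : ℝ, 0 < c →
      Tendsto (fun u : ℝ => c * u ^ (-(1/α))) (nhdsWithin 0 (Set.Ioi 0)) atTop := by
    intro c hc
    exact (tendsto_rpow_neg_nhdsGT_zero (by rw [neg_lt_zero]; positivity)).const_mul_atTop hc
  have key : ∀ c u : ℝ, 0 < c → 0 < u → (c * u ^ (-(1/α))) ^ α = c ^ α / u := by
    intro c u hc hu
    rw [Real.mul_rpow hc.le (by positivity), ← Real.rpow_mul hu.le]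
    have e2 : -(1 / α) * α = -1 := by field_simp
    rw [e2, Real.rpow_neg_one, div_eq_mul_inv]
  have hinv : ∀ u : ℝ, 0 < u → u ^ (-(1/α)) = (u ^ (1/α))⁻¹ := fun u hu => Real.rpow_neg hu.le _
  rw [tendsto_order]
  constructor
  · intro a ha
    rcases le_or_gt a 0 with h0 | h0
    · filter_upwards [hpos] with u hu
      have h1 := one_le_Qt ν hu
      have : 0 < u ^ (1/α) * Qt ν u := mul_pos (Real.rpow_pos_of_pos hu _) (by linarith)
      linarith
    · have hlt : a ^ α < 1 := Real.rpow_lt_one h0.le ha hα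
      have := (hinf a h0).eventually (htail.eventually (lt_mem_nhds hlt))
      filter_upwards [hpos, this] with u hu h
      rw [key a u h0 hu] at h
      have hap : 0 < a ^ α := Real.rpow_pos_of_pos h0 _
      have hG : u < Gt ν (a * u ^ (-(1/α))) := by
        rw [div_mul_eq_mul_div, lt_div_iff₀ hu] at h
        exact lt_of_mul_lt_mul_left h hap.le
      have : a * u ^ (-(1/α)) < Qt ν u := by
        by_contra hc
        push Not at hc
        have := ((Qt_le_iff ν hu _).1 hc).2
        linarith
      rw [hinv u hu] at this
      have hup : 0 < u ^ (1/α) := Real.rpow_pos_of_pos hu _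
      rw [← div_eq_mul_inv, div_lt_iff₀ hup] at this
      linarith
  · intro b hb
    obtain ⟨c, hc1, hcb⟩ := exists_between hb
    have hc0 : 0 < c := by linarith
    have hlt : 1 < c ^ α := Real.one_lt_rpow hc1 hα
    have h1 := (hinf c hc0).eventually (htail.eventually (gt_mem_nhds hlt))
    have h2 := (hinf c hc0).eventually (eventually_ge_atTop 1)
    filter_upwards [hpos, h1, h2] with u hu h h2
    rw [key c u hc0 hu] at h
    have hap : 0 < c ^ α := Real.rpow_pos_of_pos hc0 _
    have hG : Gt ν (c * u ^ (-(1/α))) ≤ u := by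
      rw [div_mul_eq_mul_div, div_lt_iff₀ hu] at h
      exact (lt_of_mul_lt_mul_left h hap.le).le
    have := (Qt_le_iff ν hu _).2 ⟨h2, hG⟩
    rw [hinv u hu] at this
    have hup : 0 < u ^ (1/α) := Real.rpow_pos_of_pos hu _
    rw [← div_eq_mul_inv, le_div_iff₀ hup] at this
    linarith

lemma prod_pairs_eq (k : ℕ) (F : Fin k → Fin k → ℝ) :
    ∏ p ∈ Finset.univ.filter (fun p : Fin k × Fin k => p.1 < p.2), (F p.1 p.2 * F p.2 p.1)
      = ∏ i, ∏ j ∈ Finset.univ.erase i, F i j := by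
  have h1 : ∏ p ∈ Finset.univ.filter (fun p : Fin k × Fin k => p.1 < p.2), F p.2 p.1 =
      ∏ p ∈ Finset.univ.filter (fun p : Fin k × Fin k => p.2 < p.1), F p.1 p.2 := by
    refine Finset.prod_bij' (fun p _ => (p.2, p.1)) (fun p _ => (p.2, p.1)) ?_ ?_ ?_ ?_ ?_ <;>
      simp
  rw [Finset.prod_mul_distrib, h1, Finset.prod_filter, Finset.prod_filter,
    ← Finset.prod_mul_distrib, ← Finset.univ_product_univ, Finset.prod_product]
  refine Finset.prod_congr rfl fun i _ => ?_
  have he : Finset.univ.erase i = Finset.univ.filter (fun j => j ≠ i) := by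
    ext j; simp
  rw [he, Finset.prod_filter]
  refine Finset.prod_congr rfl fun j _ => ?_
  rcases lt_trichotomy i j with h | h | h
  · simp [h, h.not_gt, h.ne']
  · simp [h]
  · simp [h, h.not_gt, h.ne]

lemma clique_bound {α ε : ℝ} (k : ℕ) (hk : 3 ≤ k) (h1 : 4 * ε ≤ α / ((k:ℝ) - 1))
    (h2 : 4 * ε ≤ 1 - α / 2) (hα : 0 < α) (hε : 0 < ε) (y : Fin k → ℝ) (hy : ∀ i, 0 < y i) :
    ∏ p ∈ Finset.univ.filter (fun p : Fin k × Fin k => p.1 < p.2), min (y p.1 * y p.2) 1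
      ≤ ∏ i, min (y i ^ (α + ε)) (y i ^ (α - ε)) := by
  have hk' : (3:ℝ) ≤ k := by exact_mod_cast hk
  obtain ⟨s, hs⟩ : ∃ s : Fin k → ℝ, ∀ i, s i = if y i ≤ 1 then 1 else -1 := ⟨_, fun _ => rfl⟩
  have hsa : ∀ i, -1 ≤ s i ∧ s i ≤ 1 := by
    intro i; rw [hs]; split_ifs <;> norm_num
  obtain ⟨T, hT⟩ : ∃ T, T = ∑ i, s i := ⟨_, rfl⟩
  have hT1 : -(k:ℝ) ≤ T := by
    have := Finset.sum_le_sum (s := Finset.univ) (fun i _ => (hsa i).1)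
    simpa [← hT] using this
  have hT2 : T ≤ k := by
    have := Finset.sum_le_sum (s := Finset.univ) (fun i _ => (hsa i).2)
    simpa [← hT] using this
  obtain ⟨θ, hθ⟩ : ∃ θ : Fin k → Fin k → ℝ, ∀ i j, θ i j =
    α / ((k:ℝ) - 1) + ε * ((s i + s j - T / ((k:ℝ) - 1)) / ((k:ℝ) - 2)) := ⟨_, fun _ _ => rfl⟩
  have hsymm : ∀ i j, θ i j = θ j i := by
    intro i j; rw [hθ, hθ, add_comm (s i)]
  have hTk : -2 ≤ T / ((k:ℝ) - 1) ∧ T / ((k:ℝ) - 1) ≤ 2 := by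
    constructor
    · rw [le_div_iff₀ (by linarith)]; linarith
    · rw [div_le_iff₀ (by linarith)]; linarith
  have hq : ∀ i j, -4 ≤ (s i + s j - T / ((k:ℝ) - 1)) / ((k:ℝ) - 2) ∧
      (s i + s j - T / ((k:ℝ) - 1)) / ((k:ℝ) - 2) ≤ 4 := by
    intro i j
    have := hsa i
    have := hsa j
    constructor
    · rw [le_div_iff₀ (by linarith)]; linarith
    · rw [div_le_iff₀ (by linarith)]; linarith
  have hαk : α / ((k:ℝ) - 1) ≤ α / 2 := by
    gcongr; linarith
  have hθ0 : ∀ i j, 0 ≤ θ i j := by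
    intro i j; rw [hθ]; nlinarith [(hq i j).1]
  have hθ1 : ∀ i j, θ i j ≤ 1 := by
    intro i j; rw [hθ]; nlinarith [(hq i j).2]
  have hmin : ∀ z t : ℝ, 0 < z → 0 ≤ t → t ≤ 1 → min z 1 ≤ z ^ t := by
    intro z t hz h0 h1
    rcases le_total z 1 with h | h
    · rw [min_eq_left h]
      calc z = z ^ (1:ℝ) := (Real.rpow_one z).symm
        _ ≤ z ^ t := Real.rpow_le_rpow_of_exponent_ge hz h h1
    · rw [min_eq_right h]
      exact Real.one_le_rpow h h0
  calc _ ≤ ∏ p ∈ Finset.univ.filter (fun p : Fin k × Fin k => p.1 < p.2),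
        (y p.1 ^ θ p.1 p.2 * y p.2 ^ θ p.2 p.1) := by
        refine Finset.prod_le_prod ?_ ?_
        · intro p _
          exact le_min (mul_pos (hy _) (hy _)).le zero_le_one
        · intro p _
          rw [hsymm p.2 p.1, ← Real.mul_rpow (hy _).le (hy _).le]
          exact hmin _ _ (mul_pos (hy _) (hy _)) (hθ0 _ _) (hθ1 _ _)
    _ = ∏ i, ∏ j ∈ Finset.univ.erase i, y i ^ θ i j :=
        prod_pairs_eq k (fun i j => y i ^ θ i j)
    _ = ∏ i, y i ^ (α + ε * s i) := by
        refine Finset.prod_congr rfl fun i _ => ?_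
        rw [← Real.rpow_sum_of_pos (hy i)]
        congr 1
        have e : ∑ j ∈ Finset.univ.erase i, s j = T - s i := by
          rw [hT, ← Finset.add_sum_erase Finset.univ s (Finset.mem_univ i)]; ring
        have c : ((Finset.univ.erase i).card : ℝ) = (k:ℝ) - 1 := by
          rw [Finset.card_erase_of_mem (Finset.mem_univ i), Finset.card_univ, Fintype.card_fin,
            Nat.cast_sub (by omega)]; simp
        simp only [hθ]
        rw [Finset.sum_add_distrib, ← Finset.mul_sum,
          ← Finset.sum_div (Finset.univ.erase i) (fun j => s i + s j - T / ((k:ℝ) - 1)),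
          Finset.sum_sub_distrib,
          Finset.sum_add_distrib, e, Finset.sum_const, Finset.sum_const, Finset.sum_const,
          nsmul_eq_mul, nsmul_eq_mul, nsmul_eq_mul, c]
        have n1 : (k:ℝ) - 1 ≠ 0 := by linarith
        have n2 : (k:ℝ) - 2 ≠ 0 := by linarith
        field_simp
        ring
    _ ≤ _ := by
        refine Finset.prod_le_prod (fun i _ => (Real.rpow_pos_of_pos (hy i) _).le) ?_
        intro i _
        rw [hs]
        split_ifs with h
        · rw [mul_one]
          exact le_min le_rfl (Real.rpow_le_rpow_of_exponent_ge (hy i) h (by linarith))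
        · have h := (not_le.1 h).le
          have : α + ε * -1 = α - ε := by ring
          rw [this]
          exact le_min (Real.rpow_le_rpow_of_exponent_le h (by linarith)) le_rfl

/-- one-variable dominating function -/
def Dm (K δ : ℝ) (t : ℝ) : ℝ :=
  (Set.Ioc (0:ℝ) 1).indicator (fun t => K * t ^ (-1 + δ)) t +
    (Set.Ioi (1:ℝ)).indicator (fun t => K * t ^ (-1 - δ)) t

lemma Dm_int (K : ℝ) {δ : ℝ} (hδ : 0 < δ) : Integrable (Dm K δ) := by
  apply Integrable.add
  · rw [integrable_indicator_iff measurableSet_Ioc]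
    have := (intervalIntegral.intervalIntegrable_rpow' (a := 0) (b := 1)
      (show -1 < -1 + δ by linarith)).1
    exact this.const_mul K
  · rw [integrable_indicator_iff measurableSet_Ioi]
    exact (integrableOn_Ioi_rpow_of_lt (show -1 - δ < -1 by linarith) one_pos).const_mul K

lemma Dm_bound {α ε C t y : ℝ} (hα : 0 < α) (hε : 0 < ε) (hεα : ε < α) (hC : 1 ≤ C) (ht : 0 < t)
    (hy : 0 < y) (h : y ≤ C * t ^ (-(1/α))) :
    min (y ^ (α + ε)) (y ^ (α - ε)) ≤ Dm (C ^ (α + ε)) (ε / α) t := by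
  have hC0 : 0 < C := by linarith
  have key : ∀ e : ℝ, 0 ≤ e → y ^ e ≤ C ^ e * t ^ (-(e / α)) := by
    intro e he
    calc y ^ e ≤ (C * t ^ (-(1/α))) ^ e := Real.rpow_le_rpow hy.le h he
      _ = _ := by
        rw [Real.mul_rpow hC0.le (by positivity), ← Real.rpow_mul ht.le]
        congr 2; ring
  rcases le_or_gt t 1 with h1 | h1
  · have : Dm (C ^ (α + ε)) (ε / α) t = C ^ (α + ε) * t ^ (-1 + ε / α) := by
      simp [Dm, ht, h1, not_lt.2 h1]
    rw [this]
    refine (min_le_right _ _).trans ((key _ (by linarith)).trans ?_)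
    have e : -((α - ε) / α) = -1 + ε / α := by field_simp; ring
    rw [e]
    gcongr
    linarith
  · have : Dm (C ^ (α + ε)) (ε / α) t = C ^ (α + ε) * t ^ (-1 - ε / α) := by
      simp [Dm, h1, not_le.2 h1]
    rw [this]
    refine (min_le_left _ _).trans ((key _ (by linarith)).trans (le_of_eq ?_))
    have e : -((α + ε) / α) = -1 - ε / α := by field_simp; ring
    rw [e]

lemma mExp_integral (ν : Measure ℝ) [IsProbabilityMeasure ν] (hsupp : ν (Set.Iio 1) = 0)
    (k : ℕ) (f : (Fin k → ℝ) → ℝ) (hf : Measurable f) :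
    ∫ x in Set.univ.pi (fun _ : Fin k => Set.Ici (1 : ℝ)), f x ∂(Measure.pi fun _ : Fin k => ν)
      = ∫ t : Fin k → ℝ, (Set.univ.pi (fun _ : Fin k => Set.Ioo (0:ℝ) 1)).indicator
          (fun t => f (fun i => Qt ν (t i))) t := by
  have hr : ν.restrict (Set.Ici 1) = ν := by
    apply Measure.restrict_eq_self_of_ae_mem
    rw [ae_iff]
    convert hsupp using 2
    ext x; simp
  rw [Measure.restrict_pi_pi, hr, integral_indicator (MeasurableSet.univ_pi fun _ => measurableSet_Ioo)]
  rw [volume_pi, Measure.restrict_pi_pi]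
  have hm := map_Qt ν hsupp
  have hsf : SigmaFinite ((volume.restrict (Set.Ioo (0:ℝ) 1)).map (Qt ν)) := by
    rw [hm]; infer_instance
  have := Measure.pi_map_pi (ι := Fin k) (μ := fun _ => volume.restrict (Set.Ioo (0:ℝ) 1))
    (f := fun _ => Qt ν) (hμ := fun _ => hsf) (fun _ => (Qt_meas ν).aemeasurable)
  simp only [hm] at this
  rw [← this, integral_map]
  · exact (measurable_pi_lambda _ fun i => (Qt_meas ν).comp (measurable_pi_apply i)).aemeasurable
  · exact hf.aestronglyMeasurable

lemma fDef_meas (μ : ℝ) (n k : ℕ) : Measurable (fDef μ n k) := by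
  unfold fDef
  refine Finset.measurable_prod _ fun p _ => ?_
  exact (((measurable_pi_apply p.1).mul (measurable_pi_apply p.2)).div_const _).min
    measurable_const

lemma fDef_bound {α ε C μ : ℝ} (k : ℕ) (hk : 3 ≤ k) (h1 : 4 * ε ≤ α / ((k:ℝ) - 1))
    (h2 : 4 * ε ≤ 1 - α / 2) (hα : 0 < α) (hε : 0 < ε) (hεα : ε < α) (hC : 1 ≤ C) (hμ : 1 ≤ μ)
    (y t : Fin k → ℝ) (hy : ∀ i, 0 < y i) (ht : ∀ i, 0 < t i)
    (h : ∀ i, y i ≤ C * t i ^ (-(1/α))) :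
    ∏ p ∈ Finset.univ.filter (fun p : Fin k × Fin k => p.1 < p.2), min (y p.1 * y p.2 / μ) 1
      ≤ ∏ i, Dm (C ^ (α + ε)) (ε / α) (t i) := by
  have hμ0 : 0 < μ := by linarith
  calc _ ≤ ∏ p ∈ Finset.univ.filter (fun p : Fin k × Fin k => p.1 < p.2),
        min (y p.1 * y p.2) 1 := by
        refine Finset.prod_le_prod (fun p _ => le_min ?_ zero_le_one) (fun p _ => ?_)
        · exact div_nonneg (mul_pos (hy _) (hy _)).le hμ0.le
        · exact min_le_min_right _ (div_le_self (mul_pos (hy _) (hy _)).le hμ)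
    _ ≤ _ := clique_bound k hk h1 h2 hα hε y hy
    _ ≤ _ := by
        refine Finset.prod_le_prod (fun i _ => ?_) (fun i _ => ?_)
        · exact le_min (Real.rpow_pos_of_pos (hy i) _).le (Real.rpow_pos_of_pos (hy i) _).le
        · exact Dm_bound hα hε hεα hC (ht i) (hy i) (h i)

lemma Dm_nonneg {K δ t : ℝ} (hK : 0 ≤ K) : 0 ≤ Dm K δ t := by
  unfold Dm
  apply add_nonneg
  · apply Set.indicator_nonneg
    intro t ht
    exact mul_nonneg hK (Real.rpow_nonneg ht.1.le _)
  · apply Set.indicator_nonneg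
    intro t ht
    exact mul_nonneg hK (Real.rpow_nonneg (zero_le_one.trans (le_of_lt ht)) _)

/-- limit integrand -/
def Lm (α μ : ℝ) (k : ℕ) (t : Fin k → ℝ) : ℝ :=
  (Set.univ.pi (fun _ : Fin k => Set.Ioi (0:ℝ))).indicator
    (fun t => ∏ p ∈ Finset.univ.filter (fun p : Fin k × Fin k => p.1 < p.2),
      min (t p.1 ^ (-(1/α)) * t p.2 ^ (-(1/α)) / μ) 1) t

/-- rescaled integrand -/
def Fm (ν : Measure ℝ) (μ : ℝ) (k n : ℕ) (t : Fin k → ℝ) : ℝ :=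
  (Set.univ.pi (fun _ : Fin k => Set.Ioo (0:ℝ) 1)).indicator
          (fun t => fDef μ n k (fun i => Qt ν (t i))) t

lemma fDef_scale (μ : ℝ) (n k : ℕ) (x : Fin k → ℝ) :
    fDef μ n k x = ∏ p ∈ Finset.univ.filter (fun p : Fin k × Fin k => p.1 < p.2),
      min ((x p.1 / Real.sqrt n) * (x p.2 / Real.sqrt n) / μ) 1 := by
  unfold fDef
  refine Finset.prod_congr rfl fun p _ => ?_
  congr 1
  rw [div_mul_div_comm, Real.mul_self_sqrt (Nat.cast_nonneg n), div_div, mul_comm μ]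

lemma Fm_meas (ν : Measure ℝ) [IsProbabilityMeasure ν] (μ : ℝ) (k n : ℕ) :
    Measurable (Fm ν μ k n) := by
  unfold Fm
  refine Measurable.indicator ?_ (MeasurableSet.univ_pi fun _ => measurableSet_Ioo)
  exact (fDef_meas μ n k).comp
    (measurable_pi_lambda _ fun i => (Qt_meas ν).comp (measurable_pi_apply i))

lemma Lm_meas (α μ : ℝ) (k : ℕ) : Measurable (Lm α μ k) := by
  unfold Lm
  refine Measurable.indicator ?_ (MeasurableSet.univ_pi fun _ => measurableSet_Ioi)
  refine Finset.measurable_prod _ fun p _ => ?_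
  exact ((((measurable_pi_apply p.1).pow_const _).mul
    ((measurable_pi_apply p.2).pow_const _)).div_const _).min measurable_const

lemma sqrt_scale {α : ℝ} (hα : 0 < α) (n : ℕ) :
    (((n:ℝ) ^ (α/2))⁻¹) ^ (1/α) = (Real.sqrt n)⁻¹ := by
  rw [Real.inv_rpow (by positivity), ← Real.rpow_mul (Nat.cast_nonneg n), Real.sqrt_eq_rpow]
  congr 2
  field_simp

lemma Qt_scaled (ν : Measure ℝ) [IsProbabilityMeasure ν] {α : ℝ} (hα : 0 < α)
    (htail : Tendsto (fun x : ℝ => x ^ α * Gt ν x) atTop (nhds 1)) (t : ℝ) (ht : 0 < t) :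
    Tendsto (fun n : ℕ => Qt ν (((n:ℝ) ^ (α/2))⁻¹ * t) / Real.sqrt n) atTop
      (nhds (t ^ (-(1/α)))) := by
  have hN : Tendsto (fun n : ℕ => ((n:ℝ) ^ (α/2))⁻¹ * t) atTop (nhdsWithin 0 (Set.Ioi 0)) := by
    rw [tendsto_nhdsWithin_iff]
    constructor
    · have h := ((tendsto_rpow_atTop (show 0 < α/2 by positivity)).comp
        tendsto_natCast_atTop_atTop).inv_tendsto_atTop.mul_const t
      rw [zero_mul] at h
      exact h
    · filter_upwards [eventually_ge_atTop 1] with n hn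
      have : (0:ℝ) < n := by exact_mod_cast hn
      simp only [Set.mem_Ioi]
      positivity
  have h := ((Qt_tendsto ν hα htail).comp hN).mul_const (t ^ (-(1/α)))
  rw [one_mul] at h
  refine h.congr fun n => ?_
  simp only [Function.comp]
  rw [Real.mul_rpow (by positivity) ht.le, sqrt_scale hα, Real.rpow_neg ht.le]
  have : t ^ (1/α) ≠ 0 := (Real.rpow_pos_of_pos ht _).ne'
  field_simp

lemma Fm_lim (ν : Measure ℝ) [IsProbabilityMeasure ν] {α μ : ℝ} (hα : 0 < α)
    (htail : Tendsto (fun x : ℝ => x ^ α * Gt ν x) atTop (nhds 1)) (k : ℕ) (t : Fin k → ℝ) :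
    Tendsto (fun n : ℕ => Fm ν μ k n (((n:ℝ) ^ (α/2))⁻¹ • t)) atTop (nhds (Lm α μ k t)) := by
  by_cases ht : ∀ i, 0 < t i
  · have hL : Lm α μ k t = ∏ p ∈ Finset.univ.filter (fun p : Fin k × Fin k => p.1 < p.2),
      min (t p.1 ^ (-(1/α)) * t p.2 ^ (-(1/α)) / μ) 1 := by
      unfold Lm
      rw [Set.indicator_of_mem]
      intro i _; exact ht i
    have h1 : ∀ᶠ n : ℕ in atTop, ∀ i, t i < (n:ℝ) ^ (α/2) := by
      rw [eventually_all]
      intro i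
      exact ((tendsto_rpow_atTop (show 0 < α/2 by positivity)).comp
        tendsto_natCast_atTop_atTop).eventually (eventually_gt_atTop (t i))
    rw [hL]
    have h2 : Tendsto (fun n : ℕ => ∏ p ∈ Finset.univ.filter (fun p : Fin k × Fin k => p.1 < p.2),
      min ((Qt ν (((n:ℝ) ^ (α/2))⁻¹ * t p.1) / Real.sqrt n) *
        (Qt ν (((n:ℝ) ^ (α/2))⁻¹ * t p.2) / Real.sqrt n) / μ) 1) atTop
        (nhds (∏ p ∈ Finset.univ.filter (fun p : Fin k × Fin k => p.1 < p.2),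
          min (t p.1 ^ (-(1/α)) * t p.2 ^ (-(1/α)) / μ) 1)) := by
      refine tendsto_finsetProd _ fun p _ => ?_
      exact (((Qt_scaled ν hα htail _ (ht p.1)).mul (Qt_scaled ν hα htail _ (ht p.2))).div_const
        μ).min tendsto_const_nhds
    refine h2.congr' ?_
    filter_upwards [h1, eventually_ge_atTop 1] with n hn hn1
    have hn0 : (0:ℝ) < n := by exact_mod_cast hn1
    have hN : 0 < (n:ℝ) ^ (α/2) := by positivity
    unfold Fm
    rw [Set.indicator_of_mem, fDef_scale]
    · simp only [Pi.smul_apply, smul_eq_mul]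
    · intro i _
      simp only [Pi.smul_apply, smul_eq_mul, Set.mem_Ioo]
      refine ⟨mul_pos (inv_pos.2 hN) (ht i), ?_⟩
      rw [inv_mul_lt_iff₀ hN, mul_one]
      exact hn i
  · have hL : Lm α μ k t = 0 := by
      unfold Lm
      rw [Set.indicator_of_notMem]
      intro h; exact ht fun i => h i trivial
    rw [hL]
    refine tendsto_const_nhds.congr fun n => ?_
    unfold Fm
    rw [Set.indicator_of_notMem]
    intro h
    apply ht
    intro i
    have := (h i trivial).1
    simp only [Pi.smul_apply, smul_eq_mul] at this
    exact (pos_iff_pos_of_mul_pos this).1 (lt_of_le_of_ne (by positivity) (fun h0 => by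
      rw [← h0] at this; simp at this))

lemma main_lim (ν : Measure ℝ) [IsProbabilityMeasure ν] {α μ : ℝ} (hα : 1 < α) (hα2 : α < 2)
    (hμ : 1 ≤ μ)
    (htail : Tendsto (fun x : ℝ => x ^ α * Gt ν x) atTop (nhds 1)) (k : ℕ) (hk : 3 ≤ k) :
    0 < ∫ t, Lm α μ k t ∧
    Tendsto (fun n : ℕ => ∫ t, Fm ν μ k n (((n:ℝ) ^ (α/2))⁻¹ • t)) atTop
      (nhds (∫ t, Lm α μ k t)) := by
  have hα0 : 0 < α := by linarith
  have hk' : (3:ℝ) ≤ k := by exact_mod_cast hk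
  have hμ0 : 0 < μ := by linarith
  obtain ⟨ε, hε, h1, h2⟩ : ∃ ε : ℝ, 0 < ε ∧ 4 * ε ≤ α / ((k:ℝ) - 1) ∧ 4 * ε ≤ 1 - α / 2 := by
    refine ⟨min (α / ((k:ℝ) - 1)) (1 - α/2) / 4, ?_, ?_, ?_⟩
    · have : 0 < α / ((k:ℝ) - 1) := div_pos hα0 (by linarith)
      have := lt_min this (show 0 < 1 - α/2 by linarith)
      linarith
    · have := min_le_left (α / ((k:ℝ) - 1)) (1 - α/2)
      linarith
    · have := min_le_right (α / ((k:ℝ) - 1)) (1 - α/2)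
      linarith
  have hεα : ε < α := by linarith
  obtain ⟨C, hC, hQ⟩ := Qt_bound ν hα0 htail
  have hK : 0 ≤ C ^ (α + ε) := by positivity
  have hDint : Integrable (fun t : Fin k → ℝ => ∏ i, Dm (C ^ (α + ε)) (ε / α) (t i)) :=
    Integrable.fintype_prod (fun _ => Dm_int _ (by positivity))
  have hDnn : ∀ t : Fin k → ℝ, 0 ≤ ∏ i, Dm (C ^ (α + ε)) (ε / α) (t i) :=
    fun t => Finset.prod_nonneg fun i _ => Dm_nonneg hK
  have hLnn : ∀ t, 0 ≤ Lm α μ k t := by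
    intro t
    apply Set.indicator_nonneg
    intro t ht
    refine Finset.prod_nonneg fun p _ => le_min ?_ zero_le_one
    have a := Real.rpow_nonneg (le_of_lt (ht p.1 trivial)) (-(1/α))
    have b := Real.rpow_nonneg (le_of_lt (ht p.2 trivial)) (-(1/α))
    positivity
  have hLint : Integrable (Lm α μ k) := by
    refine hDint.mono' (Lm_meas α μ k).aestronglyMeasurable (Eventually.of_forall fun t => ?_)
    rw [Real.norm_of_nonneg (hLnn t)]
    by_cases ht : ∀ i, 0 < t i
    · unfold Lm
      rw [Set.indicator_of_mem (show t ∈ Set.univ.pi (fun _ : Fin k => Set.Ioi (0:ℝ)) from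
        fun i _ => ht i)]
      refine fDef_bound k hk h1 h2 hα0 hε hεα hC hμ (fun i => t i ^ (-(1/α))) t
        (fun i => Real.rpow_pos_of_pos (ht i) _) ht (fun i => ?_)
      exact le_mul_of_one_le_left (Real.rpow_pos_of_pos (ht i) _).le hC
    · unfold Lm
      rw [Set.indicator_of_notMem]
      · exact hDnn t
      · intro h; exact ht fun i => h i trivial
  constructor
  · rw [integral_pos_iff_support_of_nonneg hLnn hLint]
    have hsub : Set.univ.pi (fun _ : Fin k => Set.Ioi (0:ℝ)) ⊆ Function.support (Lm α μ k) := by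
      intro t ht
      rw [Function.mem_support]
      unfold Lm
      rw [Set.indicator_of_mem ht]
      refine (Finset.prod_pos fun p _ => lt_min ?_ zero_lt_one).ne'
      have a := Real.rpow_pos_of_pos (ht p.1 trivial) (-(1/α))
      have b := Real.rpow_pos_of_pos (ht p.2 trivial) (-(1/α))
      positivity
    refine lt_of_lt_of_le ?_ (measure_mono hsub)
    refine IsOpen.measure_pos _ (isOpen_set_pi Set.finite_univ fun _ _ => isOpen_Ioi) ?_
    exact ⟨fun _ => 1, fun i _ => Set.mem_Ioi.2 one_pos⟩
  · refine tendsto_integral_filter_of_dominated_convergence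
      (fun t : Fin k → ℝ => ∏ i, Dm (C ^ (α + ε)) (ε / α) (t i)) ?_ ?_ hDint ?_
    · exact Eventually.of_forall fun n =>
        ((Fm_meas ν μ k n).comp (measurable_const_smul _)).aestronglyMeasurable
    · filter_upwards [eventually_ge_atTop 1] with n hn
      refine Eventually.of_forall fun t => ?_
      have hn0 : (0:ℝ) < n := by exact_mod_cast hn
      have hN : 0 < (n:ℝ) ^ (α/2) := by positivity
      have hsq : 0 < Real.sqrt n := Real.sqrt_pos.2 hn0
      unfold Fm
      by_cases hm : ((n:ℝ) ^ (α/2))⁻¹ • t ∈ Set.univ.pi (fun _ : Fin k => Set.Ioo (0:ℝ) 1)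
      · rw [Set.indicator_of_mem hm, fDef_scale]
        have hm' : ∀ i, 0 < ((n:ℝ) ^ (α/2))⁻¹ * t i ∧ ((n:ℝ) ^ (α/2))⁻¹ * t i < 1 :=
          fun i => hm i trivial
        have hQp : ∀ i, 0 < Qt ν (((n:ℝ) ^ (α/2))⁻¹ * t i) / Real.sqrt n := fun i =>
          div_pos (lt_of_lt_of_le one_pos (one_le_Qt ν (hm' i).1)) hsq
        have ht : ∀ i, 0 < t i := fun i => (mul_pos_iff_of_pos_left (inv_pos.2 hN)).1 (hm' i).1
        simp only [Pi.smul_apply, smul_eq_mul]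
        rw [Real.norm_of_nonneg]
        · refine fDef_bound k hk h1 h2 hα0 hε hεα hC hμ
            (fun i => Qt ν (((n:ℝ) ^ (α/2))⁻¹ * t i) / Real.sqrt n) t hQp ht (fun i => ?_)
          have := hQ _ (hm' i).1 (hm' i).2
          rw [Real.mul_rpow (by positivity) (ht i).le, Real.rpow_neg (by positivity),
            sqrt_scale hα0, inv_inv] at this
          rw [div_le_iff₀ hsq]
          linarith
        · refine Finset.prod_nonneg fun p _ => le_min ?_ zero_le_one
          exact div_nonneg (mul_pos (hQp _) (hQp _)).le hμ0.le
      · rw [Set.indicator_of_notMem hm, norm_zero]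
        exact hDnn t
    · exact Eventually.of_forall fun t => Fm_lim ν hα0 htail k t

/-- for every `k ≥ 3` there is `H > 0` with
`m_n^{(k)} = H (n P(W > √n))^k (1+o(1))`, and in particular
`m_n^{(k)}/n^{k(2-α)/2} → H`. -/
theorem stmt0
    (α : ℝ) (hα : α ∈ Set.Ioo (1 : ℝ) 2)
    (ν : Measure ℝ) [IsProbabilityMeasure ν]
    (hsupp : ν (Set.Iio 1) = 0)
    (htail : Tendsto (fun x : ℝ => x ^ α * (ν (Set.Ioi x)).toReal) atTop (nhds 1))
    (hint : Integrable (fun x : ℝ => x) ν)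
    (μ : ℝ) (hμ : μ = ∫ x, x ∂ν)
    (k : ℕ) (hk : 3 ≤ k) :
    ∃ H : ℝ, 0 < H ∧
      Tendsto (fun n : ℕ =>
          mExp ν μ k n / ((n : ℝ) * (ν (Set.Ioi (Real.sqrt n))).toReal) ^ k)
        atTop (nhds H) ∧
      Tendsto (fun n : ℕ =>
          mExp ν μ k n / (n : ℝ) ^ ((k : ℝ) * (2 - α) / 2))
        atTop (nhds H) := by
  have hα1 := hα.1
  have hα2 := hα.2
  have hα0 : 0 < α := by linarith
  have hμ1 : 1 ≤ μ := by
    rw [hμ]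
    have h : ∫ _x : ℝ, (1:ℝ) ∂ν ≤ ∫ x, x ∂ν := by
      refine integral_mono_ae (integrable_const _) hint ?_
      have : ∀ᵐ x ∂ν, ¬ x < 1 := by
        rw [ae_iff]
        simp only [not_not]
        exact hsupp
      filter_upwards [this] with x hx
      exact not_lt.1 hx
    simpa using h
  have htail' : Tendsto (fun x : ℝ => x ^ α * Gt ν x) atTop (nhds 1) := htail
  obtain ⟨hpos, hlim⟩ := main_lim ν hα1 hα2 hμ1 htail' k hk
  have hch : Tendsto (fun n : ℕ => (n.choose k : ℝ) * (1 / (n:ℝ)) ^ k) atTop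
      (nhds (1 ^ k / k.factorial)) := by
    apply ProbabilityTheory.tendsto_choose_mul_pow_atTop
    refine tendsto_const_nhds.congr' ?_
    filter_upwards [eventually_ge_atTop 1] with n hn
    have hn0 : (0:ℝ) < n := by exact_mod_cast hn
    field_simp
  have hsecond : Tendsto (fun n : ℕ => mExp ν μ k n / (n : ℝ) ^ ((k : ℝ) * (2 - α) / 2)) atTop
      (nhds (1 ^ k / k.factorial * ∫ t, Lm α μ k t)) := by
    refine (hch.mul hlim).congr' ?_
    filter_upwards [eventually_ge_atTop 1] with n hn
    have hn0 : (0:ℝ) < n := by exact_mod_cast hn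
    have hN : 0 < (n:ℝ) ^ (α/2) := by positivity
    rw [Measure.integral_comp_smul]
    have hI : mExp ν μ k n = (n.choose k : ℝ) * ∫ t, Fm ν μ k n t := by
      unfold mExp
      rw [mExp_integral ν hsupp k _ (fDef_meas μ n k)]
      rfl
    rw [hI, Module.finrank_fin_fun, abs_of_nonneg (by positivity), smul_eq_mul, inv_pow, inv_inv]
    have e : (n:ℝ) ^ ((k : ℝ) * (2 - α) / 2) = (n:ℝ) ^ k / ((n:ℝ) ^ (α/2)) ^ k := by
      rw [← Real.rpow_natCast ((n:ℝ) ^ (α/2)), ← Real.rpow_mul hn0.le, ← Real.rpow_natCast,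
        ← Real.rpow_sub hn0]
      congr 1
      ring
    rw [e, one_div, inv_pow]
    have := pow_pos hN k
    field_simp
  refine ⟨1 ^ k / k.factorial * ∫ t, Lm α μ k t, ?_, ?_, hsecond⟩
  · have : (0:ℝ) < 1 ^ k / k.factorial := by positivity
    exact mul_pos this hpos
  · have hs : Tendsto (fun n : ℕ => Real.sqrt n) atTop atTop :=
      Real.tendsto_sqrt_atTop.comp tendsto_natCast_atTop_atTop
    have h1 := (htail.comp hs).pow k
    rw [one_pow] at h1
    have h2 := hsecond.div h1 one_ne_zero
    rw [div_one] at h2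
    refine h2.congr' ?_
    filter_upwards [eventually_ge_atTop 1] with n hn
    have hn0 : (0:ℝ) < n := by exact_mod_cast hn
    simp only [Function.comp, Pi.div_apply]
    rw [div_div]
    congr 1
    have e1 : (n:ℝ) ^ ((k : ℝ) * (2 - α) / 2) = ((n:ℝ) ^ ((2 - α)/2)) ^ k := by
      rw [← Real.rpow_natCast, ← Real.rpow_mul hn0.le]
      congr 1
      ring
    rw [e1, ← mul_pow, ← mul_assoc, Real.sqrt_eq_rpow, ← Real.rpow_mul hn0.le,
      ← Real.rpow_add hn0]
    have e2 : (2 - α)/2 + 1/2 * α = 1 := by ring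
    rw [e2, Real.rpow_one]
end
end

section
/- Assume in addition α ∈ (2 − 2/k, 2) and set α* = 1 − (2 − k(2−α))/(4(α−1)). Then there exists a constant K_2 > 0 such that for every a > 0, c_a(n) = K_2 · a^{1/(2(α−1))} · n^{α*} · (1+o(1)) as n → ∞. -/
open MeasureTheory Filter Set

noncomputable section

/-- The weight vector `(x, y, c, …, c)`. -/
def hubVec (k : ℕ) (x y c : ℝ) : Fin k → ℝ :=
  fun i => if i.val = 0 then x else if i.val = 1 then y else c

/-- `∫∫ f_n(x, y, c, …, c) dF(x) dF(y)`. -/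
def twoInt (ν : Measure ℝ) (μ : ℝ) (k n : ℕ) (c : ℝ) : ℝ :=
  ∫ x in Set.Ici (1 : ℝ), ∫ y in Set.Ici (1 : ℝ),
    fDef μ n k (hubVec k x y c) ∂ν ∂ν

/-- `c_a(n)`, the smallest hub size creating an expected excess of `a m_n^{(k)}` cliques. -/
def cA (ν : Measure ℝ) (μ : ℝ) (k : ℕ) (a : ℝ) (n : ℕ) : ℝ :=
  sInf {c : ℝ | 0 < c ∧ a * mExp ν μ k n < (n.choose 2 : ℝ) * twoInt ν μ k n c}


/-- upper tail -/
def tailF (ν : Measure ℝ) (x : ℝ) : ℝ := (ν (Set.Ioi x)).toReal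

/-- tail quantile function -/
def quant (ν : Measure ℝ) (u : ℝ) : ℝ :=
  if 0 < u then sSup {x : ℝ | 0 ≤ x ∧ u < tailF ν x} else 0

lemma tailF_eq (ν : Measure ℝ) [IsProbabilityMeasure ν] (x : ℝ) :
    tailF ν x = 1 - ProbabilityTheory.cdf ν x := by
  rw [ProbabilityTheory.cdf_eq_real]
  show ν.real (Ioi x) = _
  rw [← compl_Iic, measureReal_compl measurableSet_Iic]
  simp

lemma tailF_anti (ν : Measure ℝ) [IsProbabilityMeasure ν] : Antitone (tailF ν) := by
  intro x y h
  simp only [tailF_eq]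
  have := ProbabilityTheory.monotone_cdf ν h
  linarith

lemma tailF_le_one (ν : Measure ℝ) [IsProbabilityMeasure ν] (x : ℝ) : tailF ν x ≤ 1 := by
  rw [tailF_eq]
  have := ProbabilityTheory.cdf_nonneg ν x
  linarith

lemma tailF_nonneg (ν : Measure ℝ) (x : ℝ) : 0 ≤ tailF ν x := ENNReal.toReal_nonneg

lemma tailF_tendsto (ν : Measure ℝ) [IsProbabilityMeasure ν] :
    Tendsto (tailF ν) atTop (nhds 0) := by
  have := (ProbabilityTheory.tendsto_cdf_atTop ν).const_sub 1
  simpa [funext (tailF_eq ν)] using this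

lemma lt_quant (ν : Measure ℝ) [IsProbabilityMeasure ν] {x u : ℝ} (hx : 0 ≤ x) :
    x < quant ν u ↔ 0 < u ∧ u < tailF ν x := by
  unfold quant
  split_ifs with hu
  · constructor
    · intro h
      have hne : {x : ℝ | 0 ≤ x ∧ u < tailF ν x}.Nonempty := by
        by_contra hc
        rw [Set.not_nonempty_iff_eq_empty] at hc
        rw [hc, Real.sSup_empty] at h
        linarith
      obtain ⟨y, hy, hxy⟩ := exists_lt_of_lt_csSup hne h
      exact ⟨hu, hy.2.trans_le (tailF_anti ν hxy.le)⟩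
    · rintro ⟨_, h⟩
      have hbdd : BddAbove {x : ℝ | 0 ≤ x ∧ u < tailF ν x} := by
        obtain ⟨b, hb⟩ := ((tailF_tendsto ν).eventually (gt_mem_nhds hu)).exists
        refine ⟨b, fun y hy => ?_⟩
        by_contra hc
        push Not at hc
        have := tailF_anti ν hc.le
        linarith [hy.2]
      have hrc := ((ProbabilityTheory.cdf ν).right_continuous x).tendsto
      have h1 : Tendsto (tailF ν) (nhdsWithin x (Set.Ioi x)) (nhds (tailF ν x)) := by
        have := (hrc.mono_left (nhdsWithin_mono x Set.Ioi_subset_Ici_self)).const_sub 1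
        simpa [funext (tailF_eq ν)] using this
      obtain ⟨y, hy, hxy⟩ := ((h1.eventually (lt_mem_nhds h)).and self_mem_nhdsWithin).exists
      have hxy : x < y := hxy
      exact hxy.trans_le (le_csSup hbdd ⟨hx.trans hxy.le, hy⟩)
  · constructor
    · intro h; linarith
    · rintro ⟨h, _⟩; exact absurd h hu

lemma quant_nonneg (ν : Measure ℝ) (u : ℝ) : 0 ≤ quant ν u := by
  unfold quant
  split_ifs
  · exact Real.sSup_nonneg fun x hx => hx.1
  · exact le_rfl

lemma quant_of_le (ν : Measure ℝ) {u : ℝ} (h : u ≤ 0) : quant ν u = 0 := by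
  simp [quant, not_lt.2 h]

lemma quant_of_ge (ν : Measure ℝ) [IsProbabilityMeasure ν] {u : ℝ} (h : 1 ≤ u) :
    quant ν u = 0 := by
  by_contra hc
  have h0 : 0 < quant ν u := lt_of_le_of_ne (quant_nonneg ν u) (Ne.symm hc)
  have := ((lt_quant ν le_rfl).1 h0).2
  linarith [tailF_le_one ν 0]

lemma quant_preim (ν : Measure ℝ) [IsProbabilityMeasure ν] {x : ℝ} (hx : 0 ≤ x) :
    quant ν ⁻¹' (Set.Ioi x) = Set.Ioo 0 (tailF ν x) := by
  ext u
  simp [lt_quant ν hx]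

lemma quant_meas (ν : Measure ℝ) [IsProbabilityMeasure ν] : Measurable (quant ν) := by
  refine measurable_of_Ioi fun x => ?_
  rcases le_or_gt 0 x with hx | hx
  · rw [quant_preim ν hx]; exact measurableSet_Ioo
  · have : quant ν ⁻¹' (Set.Ioi x) = Set.univ := by
      ext u
      simpa using hx.trans_le (quant_nonneg ν u)
    rw [this]; exact MeasurableSet.univ

lemma map_quant (ν : Measure ℝ) [IsProbabilityMeasure ν] (hsupp : ν (Set.Iio 1) = 0) :
    (volume.restrict (Set.Ioo (0:ℝ) 1)).map (quant ν) = ν := by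
  have : IsProbabilityMeasure (volume.restrict (Set.Ioo (0:ℝ) 1)) := ⟨by simp⟩
  have := Measure.isProbabilityMeasure_map (μ := volume.restrict (Set.Ioo (0:ℝ) 1))
    (quant_meas ν).aemeasurable
  refine ext_of_generate_finite _ (borel_eq_generateFrom_Ioi ℝ ▸ BorelSpace.measurable_eq)
    isPiSystem_Ioi ?_ (by simp)
  rintro _ ⟨x, rfl⟩
  rw [Measure.map_apply (quant_meas ν) measurableSet_Ioi]
  rcases le_or_gt 0 x with hx | hx
  · rw [quant_preim ν hx, Measure.restrict_apply measurableSet_Ioo,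
      Set.inter_eq_left.2 (Set.Ioo_subset_Ioo le_rfl (tailF_le_one ν x)), Real.volume_Ioo, sub_zero,
      tailF, ENNReal.ofReal_toReal (measure_ne_top _ _)]
  · have h1 : quant ν ⁻¹' (Set.Ioi x) = Set.univ := by
      ext u
      simpa using hx.trans_le (quant_nonneg ν u)
    rw [h1, measure_univ]
    have h2 : ν (Set.Ioi x)ᶜ = 0 := by
      refine measure_mono_null ?_ hsupp
      intro y hy
      simp at hy ⊢
      linarith
    rw [prob_compl_eq_zero_iff measurableSet_Ioi] at h2
    exact h2.symm

lemma tailF_bound (ν : Measure ℝ) [IsProbabilityMeasure ν] {α : ℝ} (hα : 0 < α)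
    (htail : Tendsto (fun x : ℝ => x ^ α * (ν (Set.Ioi x)).toReal) atTop (nhds 1)) :
    ∃ C : ℝ, 0 < C ∧ ∀ x : ℝ, 0 < x → x ^ α * tailF ν x ≤ C := by
  obtain ⟨b, hb⟩ := (htail.eventually (gt_mem_nhds (show (1:ℝ) < 2 by norm_num))).exists_forall_of_atTop
  refine ⟨2 + (max b 0) ^ α, by positivity, fun x hx => ?_⟩
  rcases le_total b x with h | h
  · have := hb x h
    have h0 : 0 ≤ (max b 0) ^ α := by positivity
    unfold tailF; linarith
  · have h1 : x ^ α ≤ (max b 0) ^ α :=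
      Real.rpow_le_rpow hx.le (h.trans (le_max_left _ _)) hα.le
    have h2 : x ^ α * tailF ν x ≤ x ^ α * 1 :=
      mul_le_mul_of_nonneg_left (tailF_le_one ν x) (by positivity)
    linarith

/-- limiting quantile -/
def phi (α : ℝ) (v : ℝ) : ℝ := if 0 < v then v ^ (-(1/α)) else 0

lemma phi_nonneg (α v : ℝ) : 0 ≤ phi α v := by
  unfold phi; split_ifs <;> positivity

lemma phi_pos (α : ℝ) {v : ℝ} (hv : 0 < v) : 0 < phi α v := by
  unfold phi; rw [if_pos hv]; positivity

lemma phi_rpow {α : ℝ} (hα : 0 < α) {v : ℝ} (hv : 0 < v) : phi α v ^ (-α) = v := by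
  rw [phi, if_pos hv, ← Real.rpow_mul hv.le]
  have : -(1/α) * -α = 1 := by field_simp
  rw [this, Real.rpow_one]

lemma phi_meas (α : ℝ) : Measurable (phi α) := by
  unfold phi
  exact Measurable.ite measurableSet_Ioi (by fun_prop) measurable_const

/-- rescaled quantile -/
def HH (ν : Measure ℝ) (α r v : ℝ) : ℝ := quant ν (r ^ (-α) * v) / r

lemma HH_meas (ν : Measure ℝ) [IsProbabilityMeasure ν] (α r : ℝ) : Measurable (HH ν α r) :=
  ((quant_meas ν).comp (measurable_const_mul _)).div_const _

lemma HH_nonneg (ν : Measure ℝ) (α : ℝ) {r : ℝ} (hr : 0 < r) (v : ℝ) : 0 ≤ HH ν α r v :=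
  div_nonneg (quant_nonneg _ _) hr.le

lemma HH_of_le (ν : Measure ℝ) (α : ℝ) {r : ℝ} (hr : 0 < r) {v : ℝ} (hv : v ≤ 0) :
    HH ν α r v = 0 := by
  unfold HH
  rw [quant_of_le, zero_div]
  exact mul_nonpos_of_nonneg_of_nonpos (by positivity) hv

lemma lt_HH (ν : Measure ℝ) [IsProbabilityMeasure ν] (α : ℝ) {r y v : ℝ} (hr : 0 < r)
    (hy : 0 < y) (hv : 0 < v) :
    y < HH ν α r v ↔ v < y ^ (-α) * ((y * r) ^ α * tailF ν (y * r)) := by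
  unfold HH
  rw [lt_div_iff₀ hr, lt_quant ν (by positivity), Real.mul_rpow hy.le hr.le]
  have h1 : y ^ (-α) * (y ^ α * r ^ α * tailF ν (y * r)) = r ^ α * tailF ν (y * r) := by
    rw [Real.rpow_neg hy.le]
    have : y ^ α ≠ 0 := by positivity
    field_simp
  rw [h1, Real.rpow_neg hr.le]
  have : 0 < r ^ α := by positivity
  constructor
  · rintro ⟨_, h⟩
    rwa [inv_mul_lt_iff₀ this] at h
  · intro h
    exact ⟨by positivity, by rwa [inv_mul_lt_iff₀ this]⟩

lemma HH_bound (ν : Measure ℝ) [IsProbabilityMeasure ν] {α : ℝ} (hα : 0 < α)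
    (htail : Tendsto (fun x : ℝ => x ^ α * (ν (Set.Ioi x)).toReal) atTop (nhds 1)) :
    ∃ C : ℝ, 0 < C ∧ ∀ r v : ℝ, 0 < r → HH ν α r v ≤ C * phi α v := by
  obtain ⟨C, hC, h⟩ := tailF_bound ν hα htail
  refine ⟨C ^ (1/α), by positivity, fun r v hr => ?_⟩
  rcases le_or_gt v 0 with hv | hv
  · rw [HH_of_le ν α hr hv]
    exact mul_nonneg (by positivity) (phi_nonneg _ _)
  · by_contra hc
    push Not at hc
    have hp := phi_pos α hv
    have hy : 0 < C ^ (1/α) * phi α v := by positivity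
    rw [lt_HH ν α hr hy hv] at hc
    have h2 := h _ (mul_pos hy hr)
    rw [Real.mul_rpow (by positivity) hp.le, phi_rpow hα hv, ← Real.rpow_mul hC.le] at hc
    have : 1/α * -α = -1 := by field_simp
    rw [this, Real.rpow_neg_one] at hc
    have h3 : C⁻¹ * v * ((C ^ (1/α) * phi α v * r) ^ α * tailF ν (C ^ (1/α) * phi α v * r))
      ≤ C⁻¹ * v * C := mul_le_mul_of_nonneg_left h2 (by positivity)
    have h4 : C⁻¹ * v * C = v := by field_simp
    linarith

lemma HH_tendsto (ν : Measure ℝ) [IsProbabilityMeasure ν] {α : ℝ} (hα : 0 < α)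
    (htail : Tendsto (fun x : ℝ => x ^ α * (ν (Set.Ioi x)).toReal) atTop (nhds 1)) (v : ℝ) :
    Tendsto (fun r => HH ν α r v) atTop (nhds (phi α v)) := by
  rcases le_or_gt v 0 with hv | hv
  · have : phi α v = 0 := by simp [phi, not_lt.2 hv]
    rw [this]
    refine tendsto_const_nhds.congr' ?_
    filter_upwards [eventually_gt_atTop 0] with r hr
    exact (HH_of_le ν α hr hv).symm
  · have hp := phi_pos α hv
    have key : ∀ y, 0 < y → Tendsto (fun r : ℝ => y ^ (-α) * ((y * r) ^ α * tailF ν (y * r))) atTop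
        (nhds (y ^ (-α))) := by
      intro y hy
      have := (htail.comp (tendsto_id.const_mul_atTop hy)).const_mul (y ^ (-α))
      simpa [tailF] using this
    rw [tendsto_order]
    constructor
    · intro y hy
      obtain ⟨z, hz, hz2⟩ := exists_between (max_lt hy hp)
      have hz0 : 0 < z := (le_max_right _ _).trans_lt hz
      have hyz : y < z := (le_max_left _ _).trans_lt hz
      have h1 : v < z ^ (-α) := by
        rw [← phi_rpow hα hv]
        exact Real.rpow_lt_rpow_of_neg hz0 hz2 (by linarith)
      filter_upwards [eventually_gt_atTop 0, (key z hz0).eventually (lt_mem_nhds h1)] with r hr h2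
      exact hyz.trans ((lt_HH ν α hr hz0 hv).2 h2)
    · intro y hy
      obtain ⟨z, hz, hz2⟩ := exists_between hy
      have hz0 : 0 < z := hp.trans hz
      have h1 : z ^ (-α) < v := by
        conv_rhs => rw [← phi_rpow hα hv]
        exact Real.rpow_lt_rpow_of_neg hp hz (by linarith)
      filter_upwards [eventually_gt_atTop 0, (key z hz0).eventually (gt_mem_nhds h1)] with r hr h2
      refine lt_of_le_of_lt ?_ hz2
      by_contra hc
      push Not at hc
      have := (lt_HH ν α hr hz0 hv).1 hc
      linarith

lemma integ_min {p q D D' : ℝ} (hp : 1 < p) (hq : q < 1) (hD : 0 ≤ D) (hD' : 0 ≤ D') :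
    Integrable (fun v : ℝ => (Set.Ioi (0:ℝ)).indicator
      (fun v => min (D * v ^ (-p)) (D' * v ^ (-q))) v) := by
  rw [integrable_indicator_iff measurableSet_Ioi, ← Set.Ioc_union_Ioi_eq_Ioi zero_le_one]
  have hm : ∀ μ' : Measure ℝ,
    AEStronglyMeasurable (fun v : ℝ => min (D * v ^ (-p)) (D' * v ^ (-q))) μ' := fun _ =>
    Measurable.aestronglyMeasurable (by fun_prop)
  refine IntegrableOn.union ?_ ?_
  · have h1 : IntegrableOn (fun v : ℝ => D' * v ^ (-q)) (Set.Ioc 0 1) := by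
      have := (intervalIntegral.intervalIntegrable_rpow' (a := 0) (b := 1)
        (show -1 < -q by linarith)).const_mul D'
      rwa [intervalIntegrable_iff_integrableOn_Ioc_of_le zero_le_one] at this
    refine Integrable.mono' h1 (hm _) ?_
    filter_upwards [ae_restrict_mem measurableSet_Ioc] with v hv
    have := hv.1
    rw [Real.norm_of_nonneg (by positivity)]
    exact min_le_right _ _
  · have h1 : IntegrableOn (fun v : ℝ => D * v ^ (-p)) (Set.Ioi 1) :=
      (integrableOn_Ioi_rpow_of_lt (show -p < -1 by linarith) zero_lt_one).const_mul D
    refine Integrable.mono' h1 (hm _) ?_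
    filter_upwards [ae_restrict_mem measurableSet_Ioi] with v hv
    have : (0:ℝ) < v := zero_lt_one.trans hv
    rw [Real.norm_of_nonneg (by positivity)]
    exact min_le_left _ _

/-- the normalised clique kernel -/
def FF (k : ℕ) (t : Fin k → ℝ) : ℝ :=
  ∏ p ∈ Finset.univ.filter (fun p : Fin k × Fin k => p.1 < p.2), min (t p.1 * t p.2) 1

lemma min_le_rpow {x θ : ℝ} (hx : 0 < x) (h0 : 0 ≤ θ) (h1 : θ ≤ 1) : min x 1 ≤ x ^ θ := by
  rcases le_total x 1 with h | h
  · refine (min_le_left _ _).trans ?_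
    conv_lhs => rw [← Real.rpow_one x]
    exact Real.rpow_le_rpow_of_exponent_ge hx h h1
  · exact (min_le_right _ _).trans (Real.one_le_rpow h h0)

lemma pair_prod (k : ℕ) (a : Fin k → Fin k → ℝ) :
    ∏ p ∈ Finset.univ.filter (fun p : Fin k × Fin k => p.1 < p.2), (a p.1 p.2 * a p.2 p.1)
      = ∏ i, ∏ j, (if i = j then 1 else a i j) := by
  rw [Finset.prod_mul_distrib, Finset.prod_filter, Finset.prod_filter, Fintype.prod_prod_type,
    Fintype.prod_prod_type_right, ← Finset.prod_mul_distrib]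
  refine Finset.prod_congr rfl fun i _ => ?_
  rw [← Finset.prod_mul_distrib]
  refine Finset.prod_congr rfl fun j _ => ?_
  rcases lt_trichotomy i j with h | h | h
  · simp [h, h.ne, not_lt.2 h.le]
  · simp [h]
  · simp [h, h.ne', not_lt.2 h.le]

lemma FF_le_prod_rpow {k : ℕ} (hk : 3 ≤ k) {α ε : ℝ} (hα : α ∈ Set.Ioo (1:ℝ) 2)
    (hε0 : 0 < ε) (hε : (3 * k - 2) * ε ≤ (k - 2) * (2 - α)) (e : Fin k → ℝ)
    (he : ∀ i, α - ε ≤ e i ∧ e i ≤ α + ε) (t : Fin k → ℝ) (ht : ∀ i, 0 < t i) :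
    FF k t ≤ ∏ i, t i ^ e i := by
  obtain ⟨h1, h2⟩ := hα
  have hK : (3:ℝ) ≤ k := by exact_mod_cast hk
  set K : ℝ := (k : ℝ) with hKdef
  set S : ℝ := ∑ i, e i with hS
  have hS1 : K * (α - ε) ≤ S := by
    have := Finset.card_nsmul_le_sum Finset.univ e (α - ε) (fun i _ => (he i).1)
    simpa using this
  have hS2 : S ≤ K * (α + ε) := by
    have := Finset.sum_le_card_nsmul Finset.univ e (α + ε) (fun i _ => (he i).2)
    simpa [mul_add] using this
  have hK1 : 0 < K - 1 := by linarith
  have hK2 : 0 < K - 2 := by linarith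
  let θ : Fin k → Fin k → ℝ := fun i j => (e i + e j - S / (K - 1)) / (K - 2)
  have hθs : ∀ i j, θ i j = θ j i := fun i j => by simp only [θ]; ring
  have hθ0 : ∀ i j, 0 ≤ θ i j := by
    intro i j
    refine div_nonneg ?_ hK2.le
    rw [sub_nonneg, div_le_iff₀ hK1]
    have ha : 2 * (α - ε) ≤ e i + e j := by linarith [(he i).1, (he j).1]
    have hb := mul_le_mul_of_nonneg_right ha hK1.le
    nlinarith
  have hθ1 : ∀ i j, θ i j ≤ 1 := by
    intro i j
    show _ / _ ≤ _
    rw [div_le_one hK2, sub_le_iff_le_add]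
    have ha : e i + e j ≤ 2 * (α + ε) := by linarith [(he i).2, (he j).2]
    refine ha.trans ?_
    rw [← sub_le_iff_le_add', le_div_iff₀ hK1]
    nlinarith
  have hsum : ∀ i, (∑ j, if i = j then 0 else θ i j) = e i := by
    intro i
    have h3 : ∀ j, (if i = j then 0 else θ i j) = θ i j - (if i = j then θ i j else 0) := by
      intro j; split_ifs <;> simp
    simp only [h3, Finset.sum_sub_distrib, Finset.sum_ite_eq, Finset.mem_univ, if_true]
    simp only [θ]
    rw [← Finset.sum_div, Finset.sum_sub_distrib, Finset.sum_add_distrib]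
    simp only [Finset.sum_const, Finset.card_univ, Fintype.card_fin, nsmul_eq_mul]
    rw [← hS, ← hKdef]
    field_simp
    ring
  calc FF k t ≤ ∏ p ∈ Finset.univ.filter (fun p : Fin k × Fin k => p.1 < p.2),
        (t p.1 ^ θ p.1 p.2 * t p.2 ^ θ p.2 p.1) := by
        refine Finset.prod_le_prod (fun p _ => ?_) (fun p _ => ?_)
        · have := ht p.1
          have := ht p.2
          positivity
        · rw [hθs p.2 p.1, ← Real.mul_rpow (ht _).le (ht _).le]
          exact min_le_rpow (mul_pos (ht _) (ht _)) (hθ0 _ _) (hθ1 _ _)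
    _ = ∏ i, ∏ j, (if i = j then 1 else t i ^ θ i j) := pair_prod k (fun i j => t i ^ θ i j)
    _ = ∏ i, t i ^ e i := by
        refine Finset.prod_congr rfl fun i _ => ?_
        rw [← hsum i, Real.rpow_sum_of_pos (ht i)]
        refine Finset.prod_congr rfl fun j _ => ?_
        split_ifs <;> simp

lemma FF_le_prod {k : ℕ} (hk : 3 ≤ k) {α : ℝ} (hα : α ∈ Set.Ioo (1:ℝ) 2) :
    ∃ ε : ℝ, 0 < ε ∧ ε < α ∧ ∀ t : Fin k → ℝ, (∀ i, 0 < t i) →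
      FF k t ≤ ∏ i, min (t i ^ (α + ε)) (t i ^ (α - ε)) := by
  obtain ⟨h1, h2⟩ := hα
  have hK : (3:ℝ) ≤ k := by exact_mod_cast hk
  refine ⟨(k - 2) * (2 - α) / (3 * k - 2), ?_, ?_, ?_⟩
  · apply div_pos
    · apply mul_pos <;> linarith
    · linarith
  · rw [div_lt_iff₀ (by linarith)]
    nlinarith
  · set ε : ℝ := (k - 2) * (2 - α) / (3 * k - 2) with hε
    have hε0 : 0 < ε := by
      apply div_pos
      · apply mul_pos <;> linarith
      · linarith
    have hε1 : (3 * k - 2) * ε ≤ (k - 2) * (2 - α) := by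
      rw [hε, mul_div_cancel₀]
      linarith
    intro t ht
    refine (FF_le_prod_rpow hk ⟨h1, h2⟩ hε0 hε1 (fun i => if t i ≤ 1 then α + ε else α - ε)
      ?_ t ht).trans ?_
    · intro i
      split_ifs <;> constructor <;> linarith
    · refine Finset.prod_le_prod (fun i _ => ?_) (fun i _ => ?_)
      · have := ht i
        positivity
      · split_ifs with h
        · exact le_min le_rfl (Real.rpow_le_rpow_of_exponent_ge (ht i) h (by linarith))
        · exact le_min (Real.rpow_le_rpow_of_exponent_le (by linarith) (by linarith)) le_rfl

lemma FF_nonneg {k : ℕ} {t : Fin k → ℝ} (ht : ∀ i, 0 ≤ t i) : 0 ≤ FF k t :=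
  Finset.prod_nonneg fun _ _ => le_min (mul_nonneg (ht _) (ht _)) zero_le_one

lemma FF_mono {k : ℕ} {t t' : Fin k → ℝ} (ht : ∀ i, 0 ≤ t i) (h : ∀ i, t i ≤ t' i) :
    FF k t ≤ FF k t' :=
  Finset.prod_le_prod (fun _ _ => le_min (mul_nonneg (ht _) (ht _)) zero_le_one)
    (fun _ _ => min_le_min (mul_le_mul (h _) (h _) (ht _) ((ht _).trans (h _))) le_rfl)

lemma FF_zero {k : ℕ} (hk : 3 ≤ k) {t : Fin k → ℝ} (i : Fin k) (hi : t i = 0) : FF k t = 0 := by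
  have : ∃ j : Fin k, j ≠ i := by
    have : Nontrivial (Fin k) := Fin.nontrivial_iff_two_le.2 (by omega)
    exact exists_ne i
  obtain ⟨j, hj⟩ := this
  rcases lt_or_gt_of_ne hj with h | h
  · exact Finset.prod_eq_zero (i := (j, i)) (by simp [h]) (by simp [hi])
  · exact Finset.prod_eq_zero (i := (i, j)) (by simpa using h) (by simp [hi])

lemma FF_cont (k : ℕ) : Continuous (FF k) := by
  unfold FF
  fun_prop

lemma FF_pos {k : ℕ} {t : Fin k → ℝ} (ht : ∀ i, 0 < t i) : 0 < FF k t :=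
  Finset.prod_pos fun _ _ => lt_min (mul_pos (ht _) (ht _)) zero_lt_one

/-- the limit constant of the clique count -/
def BB (k : ℕ) (α : ℝ) : ℝ := ∫ v : Fin k → ℝ, FF k (fun i => phi α (v i))

lemma FF_dom {k : ℕ} (hk : 3 ≤ k) {α : ℝ} (hα : α ∈ Set.Ioo (1:ℝ) 2) {C : ℝ} (hC : 0 < C) :
    ∃ g : (Fin k → ℝ) → ℝ, Integrable g ∧ ∀ (t v : Fin k → ℝ),
      (∀ i, 0 ≤ t i ∧ t i ≤ C * phi α (v i)) → FF k t ≤ g v := by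
  obtain ⟨ε, h0, h1, h⟩ := FF_le_prod hk hα
  have hα0 : 0 < α := by linarith [hα.1]
  let b : ℝ → ℝ := fun v => (Set.Ioi (0:ℝ)).indicator
      (fun v => min (C ^ (α + ε) * v ^ (-((α + ε) / α))) (C ^ (α - ε) * v ^ (-((α - ε) / α)))) v
  have hb : Integrable b := integ_min (by rw [lt_div_iff₀ hα0]; linarith)
    (by rw [div_lt_iff₀ hα0]; linarith) (by positivity) (by positivity)
  have hb0 : ∀ v, 0 ≤ b v := by
    intro v
    refine Set.indicator_nonneg (fun v hv => ?_) v
    have : 0 < v := hv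
    positivity
  refine ⟨fun v => ∏ i, b (v i), Integrable.fintype_prod (f := fun _ => b) (fun _ => hb), ?_⟩
  intro t v htv
  by_cases hv : ∀ i, 0 < v i
  · refine (FF_mono (fun i => (htv i).1) (fun i => (htv i).2)).trans ?_
    refine (h _ fun i => mul_pos hC (phi_pos α (hv i))).trans (le_of_eq ?_)
    refine Finset.prod_congr rfl fun i _ => ?_
    have hvi := hv i
    simp only [b]
    rw [Set.indicator_of_mem (show v i ∈ Set.Ioi (0:ℝ) from hvi), phi, if_pos hvi,
      Real.mul_rpow hC.le (by positivity), Real.mul_rpow hC.le (by positivity),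
      ← Real.rpow_mul hvi.le, ← Real.rpow_mul hvi.le]
    congr 3 <;> ring
  · push Not at hv
    obtain ⟨i, hi⟩ := hv
    have hti : t i = 0 := by
      have := htv i
      have h3 : phi α (v i) = 0 := by simp [phi, not_lt.2 hi]
      rw [h3, mul_zero] at this
      linarith
    rw [FF_zero hk i hti]
    exact Finset.prod_nonneg fun i _ => hb0 _

lemma FF_phi_meas (k : ℕ) (α : ℝ) : Measurable (fun v : Fin k → ℝ => FF k (fun i => phi α (v i))) :=
  (FF_cont k).measurable.comp (measurable_pi_lambda _ fun i => (phi_meas α).comp (measurable_pi_apply i))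

lemma BB_pos {k : ℕ} (hk : 3 ≤ k) {α : ℝ} (hα : α ∈ Set.Ioo (1:ℝ) 2) : 0 < BB k α := by
  obtain ⟨g, hg, h⟩ := FF_dom hk hα zero_lt_one
  have hnn : ∀ v : Fin k → ℝ, 0 ≤ FF k (fun i => phi α (v i)) := fun v =>
    FF_nonneg fun i => phi_nonneg _ _
  unfold BB
  rw [integral_pos_iff_support_of_nonneg hnn]
  · refine lt_of_lt_of_le ?_ (measure_mono
      (show Set.univ.pi (fun _ : Fin k => Set.Ioo (0:ℝ) 1) ⊆ _ from ?_))
    · rw [volume_pi_pi]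
      simp
    · intro v hv
      exact (FF_pos fun i => phi_pos α (hv i trivial).1).ne'
  · refine hg.mono' (FF_phi_meas k α).aestronglyMeasurable (ae_of_all _ fun v => ?_)
    rw [Real.norm_of_nonneg (hnn v)]
    exact h _ _ fun i => ⟨phi_nonneg _ _, by simp⟩

lemma I1_tendsto {k : ℕ} (hk : 3 ≤ k) {α : ℝ} (hα : α ∈ Set.Ioo (1:ℝ) 2)
    (ν : Measure ℝ) [IsProbabilityMeasure ν]
    (htail : Tendsto (fun x : ℝ => x ^ α * (ν (Set.Ioi x)).toReal) atTop (nhds 1)) :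
    Tendsto (fun s => ∫ v : Fin k → ℝ, FF k (fun i => HH ν α s (v i))) atTop (nhds (BB k α)) := by
  have hα0 : 0 < α := by linarith [hα.1]
  obtain ⟨C, hC, hb⟩ := HH_bound ν hα0 htail
  obtain ⟨g, hg, h⟩ := FF_dom hk hα hC
  refine tendsto_integral_filter_of_dominated_convergence g ?_ ?_ hg ?_
  · refine Eventually.of_forall fun s => Measurable.aestronglyMeasurable ?_
    exact (FF_cont k).measurable.comp
      (measurable_pi_lambda _ fun i => (HH_meas ν α s).comp (measurable_pi_apply i))
  · filter_upwards [eventually_gt_atTop 0] with s hs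
    refine ae_of_all _ fun v => ?_
    rw [Real.norm_of_nonneg (FF_nonneg fun i => HH_nonneg ν α hs _)]
    exact h _ _ fun i => ⟨HH_nonneg ν α hs _, hb _ _ hs⟩
  · refine ae_of_all _ fun v => ?_
    refine ((FF_cont k).tendsto _).comp ?_
    rw [tendsto_pi_nhds]
    exact fun i => HH_tendsto ν hα0 htail (v i)

lemma int_fDef {k : ℕ} (hk : 3 ≤ k) (α : ℝ)
    (ν : Measure ℝ) [IsProbabilityMeasure ν] (hsupp : ν (Set.Iio 1) = 0)
    {μ s : ℝ} {n : ℕ} (hs : 0 < s) (hsn : s * s = μ * n) :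
    ∫ x in Set.univ.pi (fun _ : Fin k => Set.Ici (1 : ℝ)),
      fDef μ n k x ∂(Measure.pi fun _ : Fin k => ν)
    = (s ^ (-α)) ^ k * ∫ v : Fin k → ℝ, FF k (fun i => HH ν α s (v i)) := by
  have hres : ν.restrict (Set.Ici 1) = ν := by
    refine Measure.restrict_eq_self_of_ae_mem ?_
    rw [ae_iff]
    refine measure_mono_null ?_ hsupp
    intro x hx
    simpa using hx
  have : IsProbabilityMeasure (volume.restrict (Set.Ioo (0:ℝ) 1)) := ⟨by simp⟩
  have hf : ∀ x, fDef μ n k x = FF k (fun i => x i / s) := by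
    intro x
    refine Finset.prod_congr rfl fun p _ => ?_
    rw [← hsn, div_mul_div_comm]
  have hmeas : Measurable (fun x : Fin k → ℝ => FF k (fun i => x i / s)) :=
    (FF_cont k).measurable.comp (by fun_prop)
  have hmq : Measurable (fun (x : Fin k → ℝ) i => quant ν (x i)) :=
    measurable_pi_lambda _ fun i => (quant_meas ν).comp (measurable_pi_apply i)
  have hmap : (Measure.pi fun _ : Fin k => ν)
      = (Measure.pi fun _ : Fin k => volume.restrict (Set.Ioo (0:ℝ) 1)).map
        (fun x i => quant ν (x i)) := by
    have := map_quant ν hsupp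
    have hpm : IsProbabilityMeasure ((volume.restrict (Set.Ioo (0:ℝ) 1)).map (quant ν)) := by
      rw [this]; infer_instance
    have h2 := Measure.pi_map_pi (ι := Fin k) (μ := fun _ => volume.restrict (Set.Ioo (0:ℝ) 1))
      (f := fun _ => quant ν) (hμ := fun _ => inferInstance) (fun i => (quant_meas ν).aemeasurable)
    simp only [this] at h2
    exact h2.symm
  rw [Measure.restrict_pi_pi]
  simp only [hres, hf]
  rw [hmap, integral_map hmq.aemeasurable hmeas.aestronglyMeasurable, ← Measure.restrict_pi_pi,
    setIntegral_eq_integral_of_forall_compl_eq_zero]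
  · have hR : 0 < s ^ (-α) := by positivity
    have h1 := Measure.integral_comp_smul (volume : Measure (Fin k → ℝ))
      (fun x => FF k (fun i => quant ν (x i) / s)) (s ^ (-α))
    simp only [Module.finrank_fintype_fun_eq_card, Fintype.card_fin, Pi.smul_apply, smul_eq_mul] at h1
    simp only [HH]
    rw [h1, abs_of_pos (by positivity), ← mul_assoc, mul_inv_cancel₀ (by positivity), one_mul]
    rfl
  · intro x hx
    simp only [Set.mem_pi, Set.mem_univ, true_imp_iff, not_forall, Set.mem_Ioo, not_and_or, not_lt] at hx
    obtain ⟨i, hi⟩ := hx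
    refine FF_zero hk i ?_
    show quant ν (x i) / s = 0
    rcases hi with hi | hi
    · rw [quant_of_le ν hi, zero_div]
    · rw [quant_of_ge ν hi, zero_div]

lemma prod_pairs_succ (m : ℕ) (a : Fin (m + 1) → Fin (m + 1) → ℝ) :
    ∏ i, ∏ j, (if i < j then a i j else 1) =
      (∏ j : Fin m, a 0 j.succ) *
        ∏ i : Fin m, ∏ j : Fin m, (if i < j then a i.succ j.succ else 1) := by
  rw [Fin.prod_univ_succ]
  congr 1
  · rw [Fin.prod_univ_succ]
    simp
  · refine Finset.prod_congr rfl fun i _ => ?_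
    rw [Fin.prod_univ_succ]
    simp only [Fin.not_lt_zero, if_false, one_mul, Fin.succ_lt_succ_iff]

lemma fDef_hub {m n : ℕ} {μ x y c : ℝ} (hc : min (c * c / (μ * n)) 1 = 1) :
    fDef μ n (m + 2) (hubVec (m + 2) x y c) =
      min (x * y / (μ * n)) 1 * min (x * c / (μ * n)) 1 ^ m * min (y * c / (μ * n)) 1 ^ m := by
  unfold fDef
  rw [Finset.prod_filter, Fintype.prod_prod_type]
  refine (prod_pairs_succ (m + 1) (fun i j => min (hubVec (m + 2) x y c i *
    hubVec (m + 2) x y c j / (μ * n)) 1)).trans ?_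
  rw [prod_pairs_succ m, Fin.prod_univ_succ]
  simp [hubVec, hc, mul_assoc]

/-- rescaled two-vertex kernel -/
def PP (m : ℕ) (κ a b : ℝ) : ℝ := min (a * b) κ * min a 1 ^ m * min b 1 ^ m

lemma PP_cont (m : ℕ) (κ : ℝ) : Continuous (fun p : ℝ × ℝ => PP m κ p.1 p.2) := by
  unfold PP; fun_prop

lemma PP_zero_left (m : ℕ) {κ : ℝ} (hκ : 0 ≤ κ) (b : ℝ) : PP m κ 0 b = 0 := by
  simp [PP, hκ]

lemma PP_zero_right (m : ℕ) {κ : ℝ} (hκ : 0 ≤ κ) (a : ℝ) : PP m κ a 0 = 0 := by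
  simp [PP, hκ]

lemma PP_nonneg (m : ℕ) {κ a b : ℝ} (hκ : 0 ≤ κ) (ha : 0 ≤ a) (hb : 0 ≤ b) : 0 ≤ PP m κ a b := by
  unfold PP; positivity

/-- one-vertex kernel -/
def psi (m : ℕ) (t : ℝ) : ℝ := t * min t 1 ^ m

lemma psi_cont (m : ℕ) : Continuous (psi m) := by unfold psi; fun_prop

lemma psi_nonneg (m : ℕ) {t : ℝ} (ht : 0 ≤ t) : 0 ≤ psi m t := by unfold psi; positivity

lemma psi_mono (m : ℕ) {t t' : ℝ} (ht : 0 ≤ t) (h : t ≤ t') : psi m t ≤ psi m t' := by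
  unfold psi
  have h1 : min t 1 ≤ min t' 1 := min_le_min h le_rfl
  have h2 : 0 ≤ min t 1 := le_min ht zero_le_one
  have h3 : 0 ≤ t' := ht.trans h
  gcongr

lemma PP_le (m : ℕ) {κ a b : ℝ} (ha : 0 ≤ a) (hb : 0 ≤ b) :
    PP m κ a b ≤ psi m a * psi m b := by
  unfold PP psi
  calc min (a * b) κ * min a 1 ^ m * min b 1 ^ m ≤ (a * b) * min a 1 ^ m * min b 1 ^ m := by
        have := min_le_left (a * b) κ
        gcongr
    _ = _ := by ring

lemma psi_int {m : ℕ} (hm : 1 ≤ m) {α : ℝ} (hα : α ∈ Set.Ioo (1:ℝ) 2) {C : ℝ} (hC : 0 < C) :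
    Integrable (fun v => psi m (C * phi α v)) := by
  obtain ⟨h1, h2⟩ := hα
  have hα0 : 0 < α := by linarith
  have hb := integ_min (p := 2 / α) (q := 1 / α) (D := C ^ 2) (D' := C)
    (by rw [lt_div_iff₀ hα0]; linarith) (by rw [div_lt_iff₀ hα0]; linarith)
    (by positivity) hC.le
  refine hb.mono' ((psi_cont m).measurable.comp
    ((phi_meas α).const_mul C)).aestronglyMeasurable (ae_of_all _ fun v => ?_)
  have hp := phi_nonneg α v
  have ht : 0 ≤ C * phi α v := by positivity
  rw [Real.norm_of_nonneg (psi_nonneg m ht)]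
  rcases le_or_gt v 0 with hv | hv
  · have : phi α v = 0 := by simp [phi, not_lt.2 hv]
    simp [psi, this, not_lt.2 hv]
  · rw [Set.indicator_of_mem (show v ∈ Set.Ioi (0:ℝ) from hv)]
    have e1 : C ^ 2 * v ^ (-(2 / α)) = (C * phi α v) * (C * phi α v) := by
      rw [phi, if_pos hv]
      have : v ^ (-(2/α)) = v ^ (-(1/α)) * v ^ (-(1/α)) := by
        rw [← Real.rpow_add hv]; congr 1; ring
      rw [this]; ring
    have e2 : C * v ^ (-(1 / α)) = (C * phi α v) * 1 := by
      rw [phi, if_pos hv, mul_one]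
    rw [e1, e2]
    have h3 : min (C * phi α v) 1 ^ m ≤ min (C * phi α v) 1 :=
      pow_le_of_le_one (by positivity) (min_le_right _ _) (by omega)
    unfold psi
    exact le_min (mul_le_mul_of_nonneg_left (h3.trans (min_le_left _ _)) ht)
      (mul_le_mul_of_nonneg_left (h3.trans (min_le_right _ _)) ht)

/-- the limit constant of the two-vertex integral -/
def AA (m : ℕ) (α : ℝ) : ℝ := ∫ v, psi m (phi α v)

lemma AA_pos {m : ℕ} (hm : 1 ≤ m) {α : ℝ} (hα : α ∈ Set.Ioo (1:ℝ) 2) : 0 < AA m α := by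
  unfold AA
  rw [integral_pos_iff_support_of_nonneg (fun v => psi_nonneg m (phi_nonneg _ _))]
  · refine lt_of_lt_of_le ?_ (measure_mono (show Set.Ioo (0:ℝ) 1 ⊆ _ from ?_))
    · simp
    · intro v hv
      have := phi_pos α hv.1
      have h2 : 0 < psi m (phi α v) := by unfold psi; positivity
      exact h2.ne'
  · simpa using psi_int hm hα zero_lt_one

lemma I2_tendsto {m : ℕ} (hm : 1 ≤ m) {α : ℝ} (hα : α ∈ Set.Ioo (1:ℝ) 2)
    (ν : Measure ℝ) [IsProbabilityMeasure ν]
    (htail : Tendsto (fun x : ℝ => x ^ α * (ν (Set.Ioi x)).toReal) atTop (nhds 1))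
    {r κ : ℕ → ℝ} (hr : Tendsto r atTop atTop) (hκ : Tendsto κ atTop atTop) :
    Tendsto (fun n => ∫ u, ∫ w, PP m (κ n) (HH ν α (r n) u) (HH ν α (r n) w)) atTop
      (nhds (AA m α * AA m α)) := by
  have hα0 : 0 < α := by linarith [hα.1]
  obtain ⟨C, hC, hb⟩ := HH_bound ν hα0 htail
  have hg : Integrable (fun p : ℝ × ℝ => psi m (C * phi α p.1) * psi m (C * phi α p.2))
      (volume.prod volume) := (psi_int hm hα hC).mul_prod (psi_int hm hα hC)
  have hmeas : ∀ n, AEStronglyMeasurable (fun p : ℝ × ℝ =>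
      PP m (κ n) (HH ν α (r n) p.1) (HH ν α (r n) p.2)) (volume.prod volume) := fun n =>
    ((PP_cont m (κ n)).measurable.comp (((HH_meas ν α (r n)).comp measurable_fst).prodMk
      ((HH_meas ν α (r n)).comp measurable_snd))).aestronglyMeasurable
  have hdom : ∀ᶠ n in atTop, ∀ p : ℝ × ℝ, ‖PP m (κ n) (HH ν α (r n) p.1) (HH ν α (r n) p.2)‖
      ≤ psi m (C * phi α p.1) * psi m (C * phi α p.2) := by
    filter_upwards [hr.eventually_gt_atTop 0, hκ.eventually_gt_atTop 0] with n hrn hκn p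
    have h1 := HH_nonneg ν α hrn p.1
    have h2 := HH_nonneg ν α hrn p.2
    rw [Real.norm_of_nonneg (PP_nonneg m hκn.le h1 h2)]
    refine (PP_le m h1 h2).trans ?_
    have h3 := psi_mono m h1 (hb _ p.1 hrn)
    have h4 := psi_mono m h2 (hb _ p.2 hrn)
    have h5 := psi_nonneg m h1
    have h6 := psi_nonneg m h2
    exact mul_le_mul h3 h4 h6 (h5.trans h3)
  have hlim : AA m α * AA m α = ∫ p : ℝ × ℝ, psi m (phi α p.1) * psi m (phi α p.2) ∂(volume.prod volume) :=
    (integral_prod_mul (fun v => psi m (phi α v)) (fun v => psi m (phi α v))).symm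
  rw [hlim]
  have key : Tendsto (fun n => ∫ p : ℝ × ℝ, PP m (κ n) (HH ν α (r n) p.1) (HH ν α (r n) p.2)
      ∂(volume.prod volume)) atTop
      (nhds (∫ p : ℝ × ℝ, psi m (phi α p.1) * psi m (phi α p.2) ∂(volume.prod volume))) := by
    refine tendsto_integral_filter_of_dominated_convergence _ (Eventually.of_forall hmeas)
      (hdom.mono fun n hn => ae_of_all _ hn) hg (ae_of_all _ fun p => ?_)
    have t1 := (HH_tendsto ν hα0 htail p.1).comp hr
    have t2 := (HH_tendsto ν hα0 htail p.2).comp hr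
    have t3 := (((psi_cont m).tendsto _).comp t1).mul (((psi_cont m).tendsto _).comp t2)
    refine t3.congr' ?_
    have t4 := (t1.mul t2).eventually (gt_mem_nhds (lt_add_one _))
    filter_upwards [t4, hκ.eventually_ge_atTop (phi α p.1 * phi α p.2 + 1)] with n h1 h2
    simp only [Function.comp] at h1 ⊢
    unfold PP psi
    rw [min_eq_left (h1.le.trans h2)]
    ring
  refine key.congr' ?_
  filter_upwards [hdom] with n hn
  exact integral_prod _ (hg.mono' (hmeas n) (ae_of_all _ hn))

lemma int_nu (α : ℝ) (ν : Measure ℝ) [IsProbabilityMeasure ν] (hsupp : ν (Set.Iio 1) = 0)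
    {r : ℝ} (hr : 0 < r) (h : ℝ → ℝ) (hm : Measurable h) (h0 : h 0 = 0) :
    ∫ x in Set.Ici 1, h (x / r) ∂ν = r ^ (-α) * ∫ v, h (HH ν α r v) := by
  have hres : ν.restrict (Set.Ici 1) = ν := by
    refine Measure.restrict_eq_self_of_ae_mem ?_
    rw [ae_iff]
    refine measure_mono_null ?_ hsupp
    intro x hx
    simpa using hx
  have hR : 0 < r ^ (-α) := by positivity
  rw [hres]
  conv_lhs => rw [← map_quant ν hsupp]
  have hm2 : Measurable (fun x => h (x / r)) := hm.comp (measurable_id.div_const r)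
  rw [integral_map (quant_meas ν).aemeasurable hm2.aestronglyMeasurable,
    setIntegral_eq_integral_of_forall_compl_eq_zero]
  · have h1 := Measure.integral_comp_mul_left (fun x => h (quant ν x / r)) (r ^ (-α))
    simp only [HH]
    rw [h1, abs_of_pos (by positivity), smul_eq_mul, ← mul_assoc, mul_inv_cancel₀ hR.ne', one_mul]
  · intro u hu
    simp only [Set.mem_Ioo, not_and_or, not_lt] at hu
    rcases hu with hu | hu
    · rw [quant_of_le ν hu, zero_div, h0]
    · rw [quant_of_ge ν hu, zero_div, h0]

lemma twoInt_eq {m n : ℕ} (α : ℝ) (ν : Measure ℝ) [IsProbabilityMeasure ν]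
    (hsupp : ν (Set.Iio 1) = 0) {μ c : ℝ} (hN : 0 < μ * n) (hc : 0 < c) (hcc : μ * n ≤ c * c) :
    twoInt ν μ (m + 2) n c = (μ * n / c) ^ (-α) * ((μ * n / c) ^ (-α) * (μ * n / (c * c) *
      ∫ u, ∫ w, PP m (c * c / (μ * n)) (HH ν α (μ * n / c) u) (HH ν α (μ * n / c) w))) := by
  set N := μ * n with hNdef
  set r := N / c with hrdef
  set κ := c * c / N with hκdef
  have hr : 0 < r := by positivity
  have hκ : 0 < κ := by positivity
  have hpt : ∀ x y, fDef μ n (m + 2) (hubVec (m + 2) x y c) = N / (c * c) * PP m κ (x / r) (y / r) := by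
    intro x y
    rw [fDef_hub (min_eq_right ((one_le_div hN).2 hcc))]
    unfold PP
    rw [← hNdef]
    have e1 : ∀ z, z * c / N = z / r := by intro z; rw [hrdef]; field_simp
    have e2 : min (x * y / N) 1 = N / (c * c) * min (x / r * (y / r)) κ := by
      rw [mul_min_of_nonneg _ _ (by positivity)]
      congr 1
      · rw [hrdef]; field_simp
      · rw [hκdef]; field_simp
    rw [e1, e1, e2]
    ring
  unfold twoInt
  simp only [hpt]
  have hin : ∀ x, ∫ y in Set.Ici 1, N / (c * c) * PP m κ (x / r) (y / r) ∂ν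
      = (fun a => N / (c * c) * (r ^ (-α) * ∫ w, PP m κ a (HH ν α r w))) (x / r) := by
    intro x
    rw [integral_const_mul]
    congr 1
    exact int_nu α ν hsupp hr (fun b => PP m κ (x / r) b)
      ((PP_cont m κ).measurable.comp (measurable_const.prodMk measurable_id))
      (PP_zero_right m hκ.le _)
  simp only [hin]
  have hmm : Measurable (fun a => ∫ w, PP m κ a (HH ν α r w)) := by
    refine StronglyMeasurable.measurable ?_
    refine StronglyMeasurable.integral_prod_right (f := fun a w => PP m κ a (HH ν α r w)) ?_
    refine Measurable.stronglyMeasurable ?_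
    exact (PP_cont m κ).measurable.comp
      (measurable_fst.prodMk ((HH_meas ν α r).comp measurable_snd))
  rw [int_nu α ν hsupp hr (fun a => N / (c * c) * (r ^ (-α) * ∫ w, PP m κ a (HH ν α r w)))
    ((hmm.const_mul _).const_mul _) (by simp [PP_zero_left m hκ.le])]
  rw [integral_const_mul, integral_const_mul]
  ring

lemma fDef_nonneg {μ : ℝ} (hμ : 0 ≤ μ) {n k : ℕ} {x : Fin k → ℝ} (hx : ∀ i, 0 ≤ x i) :
    0 ≤ fDef μ n k x := by
  refine Finset.prod_nonneg fun p _ => le_min ?_ zero_le_one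
  have := hx p.1
  have := hx p.2
  positivity

lemma fDef_le_one {μ : ℝ} (hμ : 0 ≤ μ) {n k : ℕ} {x : Fin k → ℝ} (hx : ∀ i, 0 ≤ x i) :
    fDef μ n k x ≤ 1 := by
  refine Finset.prod_le_one (fun p _ => le_min ?_ zero_le_one) (fun _ _ => min_le_right _ _)
  have := hx p.1
  have := hx p.2
  positivity

lemma fDef_mono {μ : ℝ} (hμ : 0 ≤ μ) {n k : ℕ} {x y : Fin k → ℝ} (hx : ∀ i, 0 ≤ x i)
    (hxy : ∀ i, x i ≤ y i) : fDef μ n k x ≤ fDef μ n k y := by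
  refine Finset.prod_le_prod (fun p _ => le_min ?_ zero_le_one)
    (fun p _ => min_le_min ?_ le_rfl)
  · have := hx p.1
    have := hx p.2
    positivity
  · have h1 := hx p.1
    have h2 := hx p.2
    have h3 := hxy p.1
    have h4 := hxy p.2
    have h5 : 0 ≤ y p.1 := h1.trans h3
    gcongr

lemma hub_meas (μ : ℝ) (n k : ℕ) (c : ℝ) :
    Measurable (fun p : ℝ × ℝ => fDef μ n k (hubVec k p.1 p.2 c)) := by
  have h1 : Continuous (fDef μ n k) := by unfold fDef; fun_prop
  refine h1.measurable.comp (measurable_pi_lambda _ fun i => ?_)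
  unfold hubVec
  split_ifs <;> fun_prop

lemma twoInt_mono {μ : ℝ} (hμ : 0 ≤ μ) (ν : Measure ℝ) [IsProbabilityMeasure ν] (n k : ℕ) {c c' : ℝ}
    (hc : 0 ≤ c) (h : c ≤ c') : twoInt ν μ k n c ≤ twoInt ν μ k n c' := by
  have hv0 : ∀ {x y d : ℝ}, 1 ≤ x → 1 ≤ y → 0 ≤ d → ∀ i, 0 ≤ hubVec k x y d i := by
    intro x y d hx hy hd i
    unfold hubVec
    split_ifs <;> linarith
  have hbd : ∀ {x y d : ℝ}, 1 ≤ x → 1 ≤ y → 0 ≤ d → ‖fDef μ n k (hubVec k x y d)‖ ≤ 1 := by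
    intro x y d hx hy hd
    rw [Real.norm_of_nonneg (fDef_nonneg hμ (hv0 hx hy hd))]
    exact fDef_le_one hμ (hv0 hx hy hd)
  have hi1 : ∀ {x d : ℝ}, 1 ≤ x → 0 ≤ d →
      IntegrableOn (fun y => fDef μ n k (hubVec k x y d)) (Set.Ici 1) ν := by
    intro x d hx hd
    refine Integrable.of_bound ((hub_meas μ n k d).comp
      (measurable_const.prodMk measurable_id)).aestronglyMeasurable 1 ?_
    filter_upwards [ae_restrict_mem measurableSet_Ici] with y hy
    exact hbd hx hy hd
  have hi2 : ∀ {d : ℝ}, 0 ≤ d →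
      IntegrableOn (fun x => ∫ y in Set.Ici 1, fDef μ n k (hubVec k x y d) ∂ν) (Set.Ici 1) ν := by
    intro d hd
    refine Integrable.of_bound (StronglyMeasurable.integral_prod_right
      (f := fun x y => fDef μ n k (hubVec k x y d))
      (hub_meas μ n k d).stronglyMeasurable).aestronglyMeasurable 1 ?_
    filter_upwards [ae_restrict_mem measurableSet_Ici] with x hx
    refine (norm_setIntegral_le_of_norm_le_const (C := 1) (measure_lt_top _ _)
      (fun y hy => hbd hx hy hd)).trans ?_
    rw [one_mul]
    exact measureReal_le_one
  refine setIntegral_mono_on (hi2 hc) (hi2 (hc.trans h)) measurableSet_Ici fun x hx => ?_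
  refine setIntegral_mono_on (hi1 hx hc) (hi1 hx (hc.trans h)) measurableSet_Ici fun y hy => ?_
  refine fDef_mono hμ (hv0 hx hy hc) fun i => ?_
  unfold hubVec
  split_ifs
  · exact le_rfl
  · exact le_rfl
  · exact h

lemma choose_tendsto (k : ℕ) :
    Tendsto (fun n : ℕ => (n.choose k : ℝ) / (n:ℝ) ^ k) atTop (nhds (1 / (k.factorial : ℝ))) := by
  have h : Tendsto (fun n : ℕ => (n:ℝ) * (1 / (n:ℝ))) atTop (nhds 1) := by
    refine tendsto_const_nhds.congr' ?_
    filter_upwards [eventually_gt_atTop 0] with n hn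
    have : (n:ℝ) ≠ 0 := by positivity
    field_simp
  have := ProbabilityTheory.tendsto_choose_mul_pow_atTop k h
  rw [one_pow] at this
  refine this.congr fun n => ?_
  rw [one_div, inv_pow, div_eq_mul_inv]

lemma m_asymp {k : ℕ} (hk : 3 ≤ k) {α : ℝ} (hα : α ∈ Set.Ioo (1:ℝ) 2)
    (ν : Measure ℝ) [IsProbabilityMeasure ν] (hsupp : ν (Set.Iio 1) = 0)
    (htail : Tendsto (fun x : ℝ => x ^ α * (ν (Set.Ioi x)).toReal) atTop (nhds 1))
    {μ : ℝ} (hμ : 0 < μ) :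
    Tendsto (fun n : ℕ => mExp ν μ k n / (n:ℝ) ^ ((k:ℝ) * (2 - α) / 2)) atTop
      (nhds (1 / (k.factorial : ℝ) * (μ ^ (-((k:ℝ) * α / 2)) * BB k α))) := by
  have hs : Tendsto (fun n : ℕ => √(μ * n)) atTop atTop :=
    Real.tendsto_sqrt_atTop.comp (tendsto_natCast_atTop_atTop.const_mul_atTop hμ)
  have h1 := (choose_tendsto k).mul (((I1_tendsto hk hα ν htail).comp hs).const_mul
    (μ ^ (-((k:ℝ) * α / 2))))
  refine h1.congr' ?_
  filter_upwards [eventually_gt_atTop 0] with n hn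
  have hn' : (0:ℝ) < n := by exact_mod_cast hn
  have hN : 0 < μ * n := by positivity
  unfold mExp
  rw [int_fDef hk α ν hsupp (Real.sqrt_pos.2 hN) (Real.mul_self_sqrt hN.le)]
  have e1 : (√(μ * n) ^ (-α)) ^ k = μ ^ (-((k:ℝ) * α / 2)) * (n:ℝ) ^ (-((k:ℝ) * α / 2)) := by
    rw [← Real.mul_rpow hμ.le hn'.le, Real.sqrt_eq_rpow, ← Real.rpow_mul hN.le,
      ← Real.rpow_natCast, ← Real.rpow_mul hN.le]
    congr 1
    ring
  have e2 : (n:ℝ) ^ ((k:ℝ) * (2 - α) / 2) = (n:ℝ) ^ k * (n:ℝ) ^ (-((k:ℝ) * α / 2)) := by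
    rw [← Real.rpow_natCast, ← Real.rpow_add hn']
    congr 1
    ring
  rw [e1, e2]
  have h3 : (n:ℝ) ^ (-((k:ℝ) * α / 2)) ≠ 0 := by positivity
  simp only [Function.comp]
  field_simp

lemma two_asymp {m : ℕ} (hm : 1 ≤ m) {α : ℝ} (hα : α ∈ Set.Ioo (1:ℝ) 2)
    (ν : Measure ℝ) [IsProbabilityMeasure ν] (hsupp : ν (Set.Iio 1) = 0)
    (htail : Tendsto (fun x : ℝ => x ^ α * (ν (Set.Ioi x)).toReal) atTop (nhds 1))
    {μ : ℝ} (hμ : 0 < μ) {β γ l : ℝ} (hβ1 : 1 / 2 < β) (hβ2 : β < 1) (hl : 0 < l)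
    (hγ : γ = 3 - 2 * α + β * (2 * (α - 1))) :
    Tendsto (fun n : ℕ => (n.choose 2 : ℝ) * twoInt ν μ (m + 2) n (l * (n:ℝ) ^ β) / (n:ℝ) ^ γ) atTop
      (nhds (1 / 2 * (μ ^ (1 - 2 * α) * l ^ (2 * (α - 1)) * (AA m α * AA m α)))) := by
  have hr : Tendsto (fun n : ℕ => μ * n / (l * (n:ℝ) ^ β)) atTop atTop := by
    have := ((tendsto_rpow_atTop (show 0 < 1 - β by linarith)).comp
      tendsto_natCast_atTop_atTop).const_mul_atTop (show 0 < μ / l by positivity)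
    refine this.congr' ?_
    filter_upwards [eventually_gt_atTop 0] with n hn
    have hn' : (0:ℝ) < n := by exact_mod_cast hn
    simp only [Function.comp]
    rw [Real.rpow_sub hn', Real.rpow_one]
    field_simp
  have hκ : Tendsto (fun n : ℕ => l * (n:ℝ) ^ β * (l * (n:ℝ) ^ β) / (μ * n)) atTop atTop := by
    have := ((tendsto_rpow_atTop (show 0 < β + β - 1 by linarith)).comp
      tendsto_natCast_atTop_atTop).const_mul_atTop (show 0 < l * l / μ by positivity)
    refine this.congr' ?_
    filter_upwards [eventually_gt_atTop 0] with n hn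
    have hn' : (0:ℝ) < n := by exact_mod_cast hn
    simp only [Function.comp]
    rw [Real.rpow_sub hn', Real.rpow_one, Real.rpow_add hn']
    field_simp
  have h1 := (choose_tendsto 2).mul ((I2_tendsto hm hα ν htail hr hκ).const_mul
    (μ ^ (1 - 2 * α) * l ^ (2 * (α - 1))))
  have h2 : ((2:ℕ).factorial : ℝ) = 2 := by norm_num [Nat.factorial]
  rw [h2] at h1
  refine h1.congr' ?_
  filter_upwards [eventually_gt_atTop 0, hκ.eventually_ge_atTop 1] with n hn hκn
  have hn' : (0:ℝ) < n := by exact_mod_cast hn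
  have hN : 0 < μ * n := by positivity
  have hc : 0 < l * (n:ℝ) ^ β := by positivity
  rw [twoInt_eq α ν hsupp hN hc ((one_le_div hN).1 hκn)]
  generalize (∫ u, ∫ w, PP m (l * (n:ℝ) ^ β * (l * (n:ℝ) ^ β) / (μ * n))
    (HH ν α (μ * n / (l * (n:ℝ) ^ β)) u) (HH ν α (μ * n / (l * (n:ℝ) ^ β)) w)) = I
  have e1 : (μ * n / (l * (n:ℝ) ^ β)) ^ (-α) * ((μ * n / (l * (n:ℝ) ^ β)) ^ (-α) *
      (μ * n / (l * (n:ℝ) ^ β * (l * (n:ℝ) ^ β)) * I))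
      = (μ ^ (1 - 2 * α) * l ^ (2 * (α - 1))) * (n:ℝ) ^ (γ - 2) * I := by
    have e2 : (μ * n / (l * (n:ℝ) ^ β)) ^ (-α) * (μ * n / (l * (n:ℝ) ^ β)) ^ (-α) *
      (μ * n / (l * (n:ℝ) ^ β * (l * (n:ℝ) ^ β)))
      = (μ ^ (1 - 2 * α) * l ^ (2 * (α - 1))) * (n:ℝ) ^ (γ - 2) := by
      rw [← Real.rpow_add (by positivity), Real.div_rpow hN.le hc.le, Real.mul_rpow hμ.le hn'.le,
        Real.mul_rpow hl.le (by positivity), ← Real.rpow_mul hn'.le]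
      have a1 : μ ^ (1 - 2 * α) = μ ^ (-α + -α) * μ := by
        conv_rhs => rw [← Real.rpow_add_one hμ.ne']
        congr 1; ring
      have a2 : (l ^ (-α + -α))⁻¹ = l ^ (2 * (α - 1)) * (l * l) := by
        rw [← Real.rpow_neg hl.le, ← mul_assoc, ← Real.rpow_add_one hl.ne', ← Real.rpow_add_one hl.ne']
        congr 1; ring
      have a3 : (n:ℝ) ^ (γ - 2) * ((n:ℝ) ^ (β * (-α + -α)) * (n:ℝ) ^ β * (n:ℝ) ^ β)
          = (n:ℝ) ^ (-α + -α) * n := by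
        conv_rhs => rw [← Real.rpow_add_one hn'.ne']
        rw [← Real.rpow_add hn', ← Real.rpow_add hn', ← Real.rpow_add hn', hγ]
        congr 1; ring
      have a4 : l ^ (2 * (α - 1)) = (l ^ (-α + -α))⁻¹ / (l * l) := by
        rw [a2]; field_simp
      have a5 : (n:ℝ) ^ (γ - 2) = (n:ℝ) ^ (-α + -α) * n /
          ((n:ℝ) ^ (β * (-α + -α)) * (n:ℝ) ^ β * (n:ℝ) ^ β) := by
        rw [← a3]; field_simp
      rw [a1, a4, a5]
      field_simp
    rw [← e2]; ring
  rw [e1, Real.rpow_sub hn']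
  have h5 : (n:ℝ) ^ (2:ℝ) = (n:ℝ) ^ 2 := by norm_cast
  rw [h5]
  field_simp

/-- if moreover `α ∈ (2 - 2/k, 2)` then, with
`α* = 1 - (2 - k(2-α))/(4(α-1))`, there is `K₂ > 0` such that for every `a > 0`,
`c_a(n) = K₂ a^{1/(2(α-1))} n^{α*} (1+o(1))`. -/
theorem stmt1
    (α : ℝ) (hα : α ∈ Set.Ioo (1 : ℝ) 2)
    (ν : Measure ℝ) [IsProbabilityMeasure ν]
    (hsupp : ν (Set.Iio 1) = 0)
    (htail : Tendsto (fun x : ℝ => x ^ α * (ν (Set.Ioi x)).toReal) atTop (nhds 1))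
    (hint : Integrable (fun x : ℝ => x) ν)
    (μ : ℝ) (hμ : μ = ∫ x, x ∂ν)
    (k : ℕ) (hk : 3 ≤ k)
    (hα2 : 2 - 2 / (k : ℝ) < α) :
    ∃ K₂ : ℝ, 0 < K₂ ∧ ∀ a : ℝ, 0 < a →
      Tendsto (fun n : ℕ =>
          cA ν μ k a n /
            (K₂ * a ^ (1 / (2 * (α - 1))) *
              (n : ℝ) ^ (1 - (2 - (k : ℝ) * (2 - α)) / (4 * (α - 1)))))
        atTop (nhds 1) := by
  obtain ⟨h1, h2⟩ := hα
  have hK : (3:ℝ) ≤ k := by exact_mod_cast hk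
  have hμ0 : 0 < μ := by
    have h3 : ∀ᵐ x ∂ν, (1:ℝ) ≤ x := by
      rw [ae_iff]
      refine measure_mono_null ?_ hsupp
      intro x hx
      simpa using hx
    have h4 : ∫ _x, (1:ℝ) ∂ν ≤ ∫ x, x ∂ν := integral_mono_ae (integrable_const _) hint h3
    rw [integral_const] at h4
    simp at h4
    linarith
  have hk2 : (k:ℝ) * (2 - α) < 2 := by
    have h3 : 2 - α < 2 / k := by linarith
    rw [lt_div_iff₀ (by linarith)] at h3
    linarith
  obtain ⟨m, rfl⟩ : ∃ m, k = m + 2 := ⟨k - 2, by omega⟩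
  have hm : 1 ≤ m := by omega
  set K : ℝ := ((m + 2 : ℕ) : ℝ) with hKdef
  set β : ℝ := 1 - (2 - K * (2 - α)) / (4 * (α - 1)) with hβ
  have hβ2 : β < 1 := by
    have : 0 < (2 - K * (2 - α)) / (4 * (α - 1)) := div_pos (by linarith) (by linarith)
    linarith
  have hβ1 : 1 / 2 < β := by
    have : (2 - K * (2 - α)) / (4 * (α - 1)) < 1 / 2 := by
      rw [div_lt_iff₀ (by linarith)]
      nlinarith
    linarith
  have hγ : K * (2 - α) / 2 = 3 - 2 * α + β * (2 * (α - 1)) := by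
    have : α - 1 ≠ 0 := by linarith
    rw [hβ]
    field_simp
    ring
  have hM := m_asymp hk ⟨h1, h2⟩ ν hsupp htail hμ0
  have hT := fun (l : ℝ) (hl : 0 < l) =>
    two_asymp hm ⟨h1, h2⟩ ν hsupp htail hμ0 hβ1 hβ2 hl hγ
  rw [← hKdef] at hM
  have hBB := BB_pos hk ⟨h1, h2⟩
  have hAA := AA_pos hm ⟨h1, h2⟩
  set M : ℝ := 1 / ((m + 2).factorial : ℝ) * (μ ^ (-(K * α / 2)) * BB (m + 2) α) with hMdef
  have hM0 : 0 < M := by positivity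
  set Nn : ℝ := 1 / 2 * (μ ^ (1 - 2 * α) * (AA m α * AA m α)) with hNdef
  have hN0 : 0 < Nn := by positivity
  set e : ℝ := 2 * (α - 1) with he
  have he0 : 0 < e := by rw [he]; linarith
  refine ⟨(M / Nn) ^ (1 / e), by positivity, fun a ha => ?_⟩
  set L : ℝ := (M / Nn) ^ (1 / e) * a ^ (1 / e) with hL
  have hL0 : 0 < L := by positivity
  have hLe : Nn * L ^ e = a * M := by
    rw [hL, ← Real.mul_rpow (by positivity) ha.le, ← Real.rpow_mul (by positivity),
      one_div_mul_cancel he0.ne', Real.rpow_one]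
    field_simp
  have hT' : ∀ l : ℝ, 0 < l → Tendsto (fun n : ℕ => (n.choose 2 : ℝ) *
      twoInt ν μ (m + 2) n (l * (n:ℝ) ^ β) / (n:ℝ) ^ (K * (2 - α) / 2)) atTop
      (nhds (Nn * l ^ e)) := by
    intro l hl
    have := hT l hl
    convert this using 2
    rw [hNdef]; ring
  have haM := hM.const_mul a
  have up : ∀ l : ℝ, L < l → ∀ᶠ n : ℕ in atTop,
      a * mExp ν μ (m + 2) n < (n.choose 2 : ℝ) * twoInt ν μ (m + 2) n (l * (n:ℝ) ^ β) := by
    intro l hl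
    have h3 : a * M < Nn * l ^ e := by
      rw [← hLe]
      exact mul_lt_mul_of_pos_left (Real.rpow_lt_rpow hL0.le hl he0) hN0
    filter_upwards [haM.eventually_lt (hT' l (hL0.trans hl)) h3, eventually_gt_atTop 0] with n h4 hn
    have hn' : (0:ℝ) < n := by exact_mod_cast hn
    rw [← mul_div_assoc, div_lt_div_iff_of_pos_right (by positivity)] at h4
    exact h4
  have down : ∀ l : ℝ, 0 < l → l < L → ∀ᶠ n : ℕ in atTop,
      (n.choose 2 : ℝ) * twoInt ν μ (m + 2) n (l * (n:ℝ) ^ β) < a * mExp ν μ (m + 2) n := by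
    intro l hl0 hl
    have h3 : Nn * l ^ e < a * M := by
      rw [← hLe]
      exact mul_lt_mul_of_pos_left (Real.rpow_lt_rpow hl0.le hl he0) hN0
    filter_upwards [(hT' l hl0).eventually_lt haM h3, eventually_gt_atTop 0] with n h4 hn
    have hn' : (0:ℝ) < n := by exact_mod_cast hn
    rw [← mul_div_assoc, div_lt_div_iff_of_pos_right (by positivity)] at h4
    exact h4
  have hbdd : ∀ n : ℕ, BddBelow {c : ℝ | 0 < c ∧ a * mExp ν μ (m + 2) n <
      (n.choose 2 : ℝ) * twoInt ν μ (m + 2) n c} := fun n => ⟨0, fun c hc => hc.1.le⟩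
  have main : Tendsto (fun n : ℕ => cA ν μ (m + 2) a n / (n:ℝ) ^ β) atTop (nhds L) := by
    rw [tendsto_order]
    constructor
    · intro y hy
      obtain ⟨l, hl, hlL⟩ := exists_between (max_lt hy hL0)
      have hl0 : 0 < l := (le_max_right _ _).trans_lt hl
      have hyl : y < l := (le_max_left _ _).trans_lt hl
      filter_upwards [down l hl0 hlL, up (L + 1) (by linarith), eventually_gt_atTop 0]
        with n h3 h4 hn
      have hn' : (0:ℝ) < n := by exact_mod_cast hn
      refine hyl.trans_le ?_
      rw [le_div_iff₀ (by positivity)]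
      refine le_csInf ⟨(L + 1) * (n:ℝ) ^ β, by positivity, h4⟩ ?_
      rintro c ⟨hc0, hc⟩
      by_contra hcon
      push Not at hcon
      have h5 := twoInt_mono hμ0.le ν n (m + 2) hc0.le hcon.le
      have h6 := mul_le_mul_of_nonneg_left h5 (Nat.cast_nonneg (α := ℝ) (n.choose 2))
      linarith
    · intro y hy
      obtain ⟨l, hl, hly⟩ := exists_between hy
      have hl0 : 0 < l := hL0.trans hl
      filter_upwards [up l hl, eventually_gt_atTop 0] with n h3 hn
      have hn' : (0:ℝ) < n := by exact_mod_cast hn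
      refine lt_of_le_of_lt ?_ hly
      rw [div_le_iff₀ (by positivity)]
      exact csInf_le (hbdd n) ⟨by positivity, h3⟩
  have fin := main.div_const L
  rw [div_self hL0.ne'] at fin
  refine fin.congr fun n => ?_
  rw [div_div, mul_comm]
end
end
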